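/- Let B be an open ball of ℝ^d centered at the origin and let u, v ∈ C(closure of B) be nonnegative distributional solutions of Δ_k w = φ(w) in B. If u ≥ v on ∂B, then u ≥ v on B. -/

import Mathlib

open MeasureTheory Real Filter
open scoped RealInnerProductSpace ENNReal Topology

noncomputable section

abbrev E (d : ℕ) := EuclideanSpace ℝ (Fin d)

/-- The reflection σ_α in the hyperplane orthogonal to α. -/
def dunklReflect {d : ℕ} (α x : E d) : E d := x - ((2 * ⟪α, x⟫) / ‖α‖ ^ 2) • α

/-- The Euclidean Laplacian, as the trace of the second derivative. -/
def lap {d : ℕ} (u : E d → ℝ) (x : E d) : ℝ :=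
  ∑ i : Fin d, iteratedFDeriv ℝ 2 u x ![EuclideanSpace.single i 1, EuclideanSpace.single i 1]

/-- The Dunkl Laplacian Δ_k associated with the root system `R` and multiplicity `k`. -/
def dunklLap {d : ℕ} (R : Finset (E d)) (k : E d → ℝ) (u : E d → ℝ) (x : E d) : ℝ :=
  lap u x + ∑ α ∈ R, k α * (⟪gradient u x, α⟫ / ⟪α, x⟫ -
    (‖α‖ ^ 2 / 2) * ((u x - u (dunklReflect α x)) / ⟪α, x⟫ ^ 2))

/-- The weight function w_k. -/
def wk {d : ℕ} (R : Finset (E d)) (k : E d → ℝ) (x : E d) : ℝ :=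
  ∏ α ∈ R, |⟪x, α⟫| ^ (k α)

/-- `u` is a distributional solution of Δ_k u = φ(u) on `D`. -/
def IsDunklSol {d : ℕ} (R : Finset (E d)) (k : E d → ℝ) (φ : ℝ → ℝ) (D : Set (E d))
    (u : E d → ℝ) : Prop :=
  ∀ ψ : E d → ℝ, ContDiff ℝ (⊤ : ℕ∞) ψ → HasCompactSupport ψ → tsupport ψ ⊆ D →
    ∫ x in D, u x * dunklLap R k ψ x * wk R k x = ∫ x in D, φ (u x) * ψ x * wk R k x

/-- The derivative of `f` in the direction `a`. -/
def dd {d : ℕ} (a : E d) (f : E d → ℝ) : E d → ℝ := fun x => fderiv ℝ f x a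

/-- Smoothness of real functions on `E d`. -/
abbrev Smooth {d : ℕ} (f : E d → ℝ) : Prop := ContDiff ℝ (⊤ : ℕ∞) f

section Calculus

variable {d : ℕ} {f g : E d → ℝ}

lemma Smooth.differentiable (hf : Smooth f) : Differentiable ℝ f :=
  ContDiff.differentiable hf (by simp)

lemma Smooth.dd (hf : Smooth f) (a : E d) : Smooth (dd a f) :=
  (ContDiff.fderiv_right (m := ((⊤ : ℕ∞) : WithTop ℕ∞)) hf (by norm_cast)).clm_apply
    contDiff_const

lemma dd_const (a : E d) (c : ℝ) : dd a (fun _ => c) = fun _ => 0 := by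
  funext x
  simp [dd]

lemma dd_add (hf : Smooth f) (hg : Smooth g) (a : E d) :
    dd a (fun x => f x + g x) = fun x => dd a f x + dd a g x := by
  funext x
  simp only [dd]
  rw [fderiv_fun_add (hf.differentiable x) (hg.differentiable x)]
  rfl

lemma dd_mul (hf : Smooth f) (hg : Smooth g) (a : E d) :
    dd a (fun x => f x * g x) = fun x => f x * dd a g x + dd a f x * g x := by
  funext x
  simp only [dd]
  rw [fderiv_fun_mul (hf.differentiable x) (hg.differentiable x)]
  simp [mul_comm]

lemma dd_dd_add (hf : Smooth f) (hg : Smooth g) (a : E d) :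
    dd a (dd a (fun x => f x + g x)) = fun x => dd a (dd a f) x + dd a (dd a g) x := by
  rw [dd_add hf hg, dd_add (hf.dd a) (hg.dd a)]

lemma dd_dd_mul (hf : Smooth f) (hg : Smooth g) (a : E d) :
    dd a (dd a (fun x => f x * g x)) =
      fun x => f x * dd a (dd a g) x + 2 * (dd a f x * dd a g x) + dd a (dd a f) x * g x := by
  rw [dd_mul hf hg, dd_add (hf.mul (hg.dd a)) ((hf.dd a).mul hg), dd_mul hf (hg.dd a),
    dd_mul (hf.dd a) hg]
  funext x
  ring

lemma smooth_coord (i : Fin d) : Smooth (fun x : E d => x i) :=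
  (EuclideanSpace.proj (𝕜 := ℝ) i).contDiff

lemma dd_coord (a : E d) (i : Fin d) : dd a (fun x : E d => x i) = fun _ => a i := by
  funext x
  have h : HasFDerivAt (fun x : E d => x i) (EuclideanSpace.proj (𝕜 := ℝ) i : E d →L[ℝ] ℝ) x :=
    (EuclideanSpace.proj (𝕜 := ℝ) i : E d →L[ℝ] ℝ).hasFDerivAt
  simp [dd, h.fderiv]

/-- Along a line, `dd` is the ordinary derivative. -/
lemma deriv_line (hf : Smooth f) (x a : E d) (t : ℝ) :
    HasDerivAt (fun t : ℝ => f (x + t • a)) (dd a f (x + t • a)) t := by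
  have h1 : HasDerivAt (fun t : ℝ => x + t • a) a t := by
    simpa using ((hasDerivAt_id t).smul_const a).const_add x
  exact ((hf.differentiable (x + t • a)).hasFDerivAt).comp_hasDerivAt t h1

lemma dd_eq_zero_of_isLocalMax {x : E d} (h : IsLocalMax f x) (a : E d) : dd a f x = 0 := by
  simp [dd, h.fderiv_eq_zero]

lemma dd_dd_nonpos_of_isLocalMax (hf : Smooth f) {x : E d} (h : IsLocalMax f x) (a : E d) :
    dd a (dd a f) x ≤ 0 := by
  by_contra! hpos
  set F : ℝ → ℝ := fun t => f (x + t • a) with hF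
  have hd : deriv F = fun t => dd a f (x + t • a) := funext fun t => (deriv_line hf x a t).deriv
  have hdd : deriv (deriv F) = fun t => dd a (dd a f) (x + t • a) := by
    rw [hd]
    exact funext fun t => (deriv_line (hf.dd a) x a t).deriv
  have hcont : Continuous (fun t : ℝ => x + t • a) := by fun_prop
  have hmax : IsLocalMax F 0 := by
    have := hcont.tendsto 0
    simp only [zero_smul, add_zero] at this
    have h2 := this.eventually h
    simpa [IsLocalMax, IsMaxFilter, hF] using h2
  have hmin : IsLocalMin F 0 := by
    apply isLocalMin_of_deriv_deriv_pos
    · rw [hdd]; simpa using hpos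
    · exact hmax.deriv_eq_zero
    · exact (deriv_line hf x a 0).continuousAt
  have hconst : F =ᶠ[𝓝 0] fun _ => F 0 := by
    filter_upwards [hmax, hmin] with t h1 h2
    exact le_antisymm h1 h2
  have : deriv (deriv F) 0 = 0 := by
    rw [(hconst.deriv).deriv_eq]
    simp
  rw [hdd] at this
  simp at this
  linarith

end Calculus

section Reflection

variable {d : ℕ}

lemma inner_eq_sum (a x : E d) : ⟪a, x⟫ = ∑ i, a i * x i := by
  simp [PiLp.inner_apply, mul_comm]

lemma dunklReflect_of_inner_eq_zero {α x : E d} (h : ⟪α, x⟫ = 0) : dunklReflect α x = x := by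
  simp [dunklReflect, h]

lemma dunklReflect_apply (α x : E d) (i : Fin d) :
    dunklReflect α x i = x i - (2 / ‖α‖ ^ 2) * ⟪α, x⟫ * α i := by
  simp only [dunklReflect, PiLp.sub_apply, PiLp.smul_apply, smul_eq_mul]
  ring

lemma dunklReflect_eq_reflection (α : E d) : dunklReflect α = (ℝ ∙ α)ᗮ.reflection := by
  funext x
  rw [Submodule.reflection_orthogonal_apply, Submodule.reflection_singleton_apply, dunklReflect]
  simp [two_smul, two_mul, add_div, add_smul]

lemma norm_dunklReflect (α x : E d) : ‖dunklReflect α x‖ = ‖x‖ := by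
  rw [dunklReflect_eq_reflection, LinearIsometryEquiv.norm_map]

lemma dunklReflect_dunklReflect (α x : E d) : dunklReflect α (dunklReflect α x) = x := by
  rw [dunklReflect_eq_reflection, Submodule.reflection_reflection]

lemma inner_dunklReflect_dunklReflect (α x y : E d) :
    ⟪dunklReflect α x, dunklReflect α y⟫ = ⟪x, y⟫ := by
  rw [dunklReflect_eq_reflection, LinearIsometryEquiv.inner_map_map]

lemma measurePreserving_dunklReflect (α : E d) :
    MeasurePreserving (dunklReflect α) volume volume := by
  rw [dunklReflect_eq_reflection]
  exact LinearIsometryEquiv.measurePreserving _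

lemma measurableEmbedding_dunklReflect (α : E d) : MeasurableEmbedding (dunklReflect α) := by
  rw [dunklReflect_eq_reflection]
  exact (ℝ ∙ α)ᗮ.reflection.toHomeomorph.measurableEmbedding

lemma smooth_dunklReflect (α : E d) : ContDiff ℝ (⊤ : ℕ∞) (dunklReflect α) := by
  rw [dunklReflect_eq_reflection]
  exact (ℝ ∙ α)ᗮ.reflection.contDiff

lemma inner_dunklReflect_self (α x : E d) (hα : α ≠ 0) :
    ⟪α, dunklReflect α x⟫ = -⟪α, x⟫ := by
  have : ‖α‖ ≠ 0 := norm_ne_zero_iff.2 hα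
  simp only [dunklReflect, inner_sub_right, inner_smul_right, real_inner_self_eq_norm_sq]
  field_simp
  ring

lemma inner_dunklReflect_left (α x y : E d) :
    ⟪dunklReflect α x, y⟫ = ⟪x, dunklReflect α y⟫ := by
  rw [← inner_dunklReflect_dunklReflect α x (dunklReflect α y), dunklReflect_dunklReflect]

end Reflection

open Classical in
/-- The difference quotient `(f(x) - f(σ_α x)) / ⟨α, x⟩`, extended to the hyperplane. -/
def dquot {d : ℕ} (α : E d) (f : E d → ℝ) (x : E d) : ℝ :=
  if ⟪α, x⟫ = 0 then 2 / ‖α‖ ^ 2 * dd α f x else (f x - f (dunklReflect α x)) / ⟪α, x⟫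

open Classical in
/-- The contribution of the root `α` to the Dunkl Laplacian, extended to the hyperplane. -/
def rootTerm {d : ℕ} (α : E d) (f : E d → ℝ) (x : E d) : ℝ :=
  if ⟪α, x⟫ = 0 then dd α (dd α f) x / ‖α‖ ^ 2 else
    dd α f x / ⟪α, x⟫ - (‖α‖ ^ 2 / 2) * ((f x - f (dunklReflect α x)) / ⟪α, x⟫ ^ 2)

/-- The Laplacian as a sum of iterated directional derivatives. -/
def sumLap {d : ℕ} (f : E d → ℝ) (x : E d) : ℝ :=
  ∑ i : Fin d, dd (EuclideanSpace.single i 1) (dd (EuclideanSpace.single i 1) f) x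

/-- The Dunkl Laplacian, extended to the reflecting hyperplanes. -/
def extLap {d : ℕ} (R : Finset (E d)) (k : E d → ℝ) (f : E d → ℝ) (x : E d) : ℝ :=
  sumLap f x + ∑ α ∈ R, k α * rootTerm α f x

/-- `IsPol n f`: the function `f` is a polynomial of degree less than `n`. -/
inductive IsPol {d : ℕ} : ℕ → (E d → ℝ) → Prop
  | zero (n : ℕ) : IsPol n (fun _ => 0)
  | const (n : ℕ) (c : ℝ) : IsPol (n + 1) (fun _ => c)
  | add {n : ℕ} {f g : E d → ℝ} : IsPol n f → IsPol n g → IsPol n (fun x => f x + g x)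
  | coord {n : ℕ} {f : E d → ℝ} (i : Fin d) : IsPol n f → IsPol (n + 1) (fun x => x i * f x)

section ExtLap

variable {d : ℕ} {f g : E d → ℝ}

lemma lap_eq_sumLap (hf : Smooth f) (x : E d) : lap f x = sumLap f x := by
  unfold lap sumLap
  refine Finset.sum_congr rfl fun i _ => ?_
  rw [iteratedFDeriv_two_apply]
  simp only [Matrix.cons_val_zero, Matrix.cons_val_one]
  set e : E d := EuclideanSpace.single i 1
  have h1 : DifferentiableAt ℝ (fderiv ℝ f) x :=
    (ContDiff.fderiv_right (m := 1) hf (by norm_cast)).differentiable (by simp) x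
  have h2 : HasFDerivAt (fun y => fderiv ℝ f y e)
      ((ContinuousLinearMap.apply ℝ ℝ e).comp (fderiv ℝ (fderiv ℝ f) x)) x :=
    (ContinuousLinearMap.apply ℝ ℝ e).hasFDerivAt.comp x h1.hasFDerivAt
  change _ = fderiv ℝ (fun y => fderiv ℝ f y e) x e
  rw [h2.fderiv]
  rfl

lemma dunklLap_eq_extLap (R : Finset (E d)) (k : E d → ℝ) (hf : Smooth f) {x : E d}
    (hx : ∀ α ∈ R, ⟪α, x⟫ ≠ 0) : dunklLap R k f x = extLap R k f x := by
  unfold dunklLap extLap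
  rw [lap_eq_sumLap hf]
  congr 1
  refine Finset.sum_congr rfl fun α hα => ?_
  rw [rootTerm, if_neg (hx α hα), inner_gradient_left]
  rfl

lemma sumLap_add (hf : Smooth f) (hg : Smooth g) (x : E d) :
    sumLap (fun x => f x + g x) x = sumLap f x + sumLap g x := by
  simp only [sumLap, dd_dd_add hf hg, Finset.sum_add_distrib]

lemma dquot_add (hf : Smooth f) (hg : Smooth g) (α x : E d) :
    dquot α (fun x => f x + g x) x = dquot α f x + dquot α g x := by
  simp only [dquot, dd_add hf hg]
  split_ifs <;> ring

lemma rootTerm_add (hf : Smooth f) (hg : Smooth g) (α x : E d) :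
    rootTerm α (fun x => f x + g x) x = rootTerm α f x + rootTerm α g x := by
  simp only [rootTerm, dd_add hf hg, dd_add (hf.dd α) (hg.dd α)]
  split_ifs <;> ring

lemma extLap_add (R : Finset (E d)) (k : E d → ℝ) (hf : Smooth f) (hg : Smooth g) (x : E d) :
    extLap R k (fun x => f x + g x) x = extLap R k f x + extLap R k g x := by
  simp only [extLap, sumLap_add hf hg, rootTerm_add hf hg, mul_add, Finset.sum_add_distrib]
  ring

lemma dd_const_mul (hf : Smooth f) (c : ℝ) (a : E d) :
    dd a (fun x => c * f x) = fun x => c * dd a f x := by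
  rw [dd_mul contDiff_const hf, dd_const]
  simp

lemma extLap_const_mul (R : Finset (E d)) (k : E d → ℝ) (hf : Smooth f) (c : ℝ) (x : E d) :
    extLap R k (fun x => c * f x) x = c * extLap R k f x := by
  have h : ∀ α, rootTerm α (fun x => c * f x) x = c * rootTerm α f x := by
    intro α
    simp only [rootTerm, dd_const_mul hf, dd_const_mul (hf.dd α)]
    split_ifs <;> ring
  simp only [extLap, h, sumLap, dd_const_mul hf, dd_const_mul (hf.dd _), mul_add, Finset.mul_sum]
  congr 1
  exact Finset.sum_congr rfl fun α _ => by ring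

lemma dquot_const (α : E d) (c : ℝ) : dquot α (fun _ => c) = fun _ => 0 := by
  funext x
  simp [dquot, dd_const]

lemma rootTerm_const (α : E d) (c : ℝ) : rootTerm α (fun _ => c) = fun _ => 0 := by
  funext x
  simp [rootTerm, dd_const]

lemma dquot_coord_mul (hf : Smooth f) (α x : E d) (i : Fin d) :
    dquot α (fun x => x i * f x) x =
      x i * dquot α f x + 2 / ‖α‖ ^ 2 * α i * f (dunklReflect α x) := by
  simp only [dquot, dd_mul (smooth_coord i) hf, dd_coord]
  split_ifs with h
  · rw [dunklReflect_of_inner_eq_zero h]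
    ring
  · rw [dunklReflect_apply]
    field_simp
    ring

lemma rootTerm_coord_mul (hf : Smooth f) {α : E d} (hα : α ≠ 0) (x : E d) (i : Fin d) :
    rootTerm α (fun x => x i * f x) x = x i * rootTerm α f x + α i * dquot α f x := by
  have hn : ‖α‖ ≠ 0 := norm_ne_zero_iff.2 hα
  simp only [rootTerm, dquot]
  rw [dd_dd_mul (smooth_coord i) hf, dd_mul (smooth_coord i) hf, dd_coord, dd_const]
  split_ifs with h
  · field_simp
    ring
  · rw [dunklReflect_apply]
    field_simp
    ring

end ExtLap

namespace IsPol

variable {d : ℕ} {n : ℕ} {f g : E d → ℝ}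

lemma smooth (h : IsPol n f) : Smooth f := by
  induction h with
  | zero => exact contDiff_const
  | const => exact contDiff_const
  | add _ _ h1 h2 => exact h1.add h2
  | coord i _ h => exact (smooth_coord i).mul h

lemma analytic (h : IsPol n f) : AnalyticOnNhd ℝ f Set.univ := by
  induction h with
  | zero => exact analyticOnNhd_const
  | const => exact analyticOnNhd_const
  | add _ _ h1 h2 => exact h1.add h2
  | coord i _ h =>
    exact AnalyticOnNhd.mul ((EuclideanSpace.proj (𝕜 := ℝ) i : E d →L[ℝ] ℝ).analyticOnNhd _) h

lemma eq_zero (h : IsPol 0 f) : f = fun _ => 0 := by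
  have key : ∀ m (f : E d → ℝ), IsPol m f → m = 0 → f = fun _ => 0 := by
    intro m f h
    induction h with
    | zero => intro _; rfl
    | const => intro h; omega
    | add _ _ h1 h2 => intro h; funext x; simp [h1 h, h2 h]
    | coord => intro h; omega
  exact key 0 f h rfl

lemma succ (h : IsPol n f) : IsPol (n + 1) f := by
  induction h with
  | zero => exact zero _
  | const => exact const _ _
  | add _ _ h1 h2 => exact h1.add h2
  | coord i _ h => exact h.coord i

lemma mono {m : ℕ} (h : IsPol n f) (hnm : n ≤ m) : IsPol m f := by
  induction hnm with
  | refl => exact h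
  | step _ ih => exact ih.succ

lemma const_mul (h : IsPol n f) (c : ℝ) : IsPol n (fun x => c * f x) := by
  induction h with
  | zero => simpa using zero _
  | const => exact const _ _
  | add _ _ h1 h2 => simpa only [mul_add] using h1.add h2
  | @coord n f i _ h => simpa only [mul_left_comm] using h.coord i

lemma sum {ι : Type*} (s : Finset ι) {F : ι → E d → ℝ} (h : ∀ i ∈ s, IsPol n (F i)) :
    IsPol n (fun x => ∑ i ∈ s, F i x) := by
  classical
  induction s using Finset.induction_on with
  | empty => simpa using zero n
  | insert a s ha ih =>
    simp only [Finset.sum_insert ha]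
    exact (h a (by simp)).add (ih fun i hi => h i (by simp [hi]))

lemma coord_pred (i : Fin d) (h : IsPol (n - 1) f) : IsPol n (fun x => x i * f x) := by
  cases n with
  | zero => rw [h.eq_zero]; simpa using zero 0
  | succ n => exact coord i h

lemma inner_mul (h : IsPol n f) (a : E d) : IsPol (n + 1) (fun x => ⟪a, x⟫ * f x) := by
  simp only [inner_eq_sum, Finset.sum_mul, mul_assoc]
  exact sum _ fun i _ => (h.coord i).const_mul (a i)

lemma mul {m : ℕ} (hf : IsPol n f) (hg : IsPol m g) : IsPol (n + m) (fun x => f x * g x) := by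
  induction hf with
  | zero => simpa using zero _
  | const => exact (hg.const_mul _).mono (by omega)
  | add _ _ h1 h2 => simpa only [add_mul] using h1.add h2
  | coord i _ h => simpa only [mul_assoc] using (h.coord i).mono (by omega)

lemma comp_dunklReflect (h : IsPol n f) (α : E d) : IsPol n (fun x => f (dunklReflect α x)) := by
  induction h with
  | zero => exact zero _
  | const => exact const _ _
  | add _ _ h1 h2 => exact h1.add h2
  | @coord n f i _ h =>
    have := (h.coord i).add ((h.inner_mul α).const_mul (-(2 / ‖α‖ ^ 2 * α i)))
    convert this using 2 with x
    simp only [dunklReflect_apply]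
    ring

lemma dd (h : IsPol n f) (a : E d) : IsPol (n - 1) (dd a f) := by
  induction h with
  | zero => rw [dd_const]; exact zero _
  | const => rw [dd_const]; exact zero _
  | add hf hg h1 h2 => rw [dd_add hf.smooth hg.smooth]; exact h1.add h2
  | coord i hf h =>
    rw [dd_mul (smooth_coord i) hf.smooth, dd_coord]
    exact (h.coord_pred i).add (hf.const_mul (a i))

lemma dquot (h : IsPol n f) (α : E d) : IsPol (n - 1) (dquot α f) := by
  induction h with
  | zero => rw [dquot_const]; exact zero _
  | const => rw [dquot_const]; exact zero _
  | add hf hg h1 h2 => rw [funext (dquot_add hf.smooth hg.smooth α)]; exact h1.add h2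
  | coord i hf h =>
    rw [funext fun x => dquot_coord_mul hf.smooth α x i]
    exact (h.coord_pred i).add ((hf.comp_dunklReflect α).const_mul _)

lemma rootTerm (h : IsPol n f) {α : E d} (hα : α ≠ 0) : IsPol (n - 2) (rootTerm α f) := by
  induction h with
  | zero => rw [rootTerm_const]; exact zero _
  | const => rw [rootTerm_const]; exact zero _
  | add hf hg h1 h2 => rw [funext (rootTerm_add hf.smooth hg.smooth α)]; exact h1.add h2
  | @coord n f i hf h =>
    rw [funext fun x => rootTerm_coord_mul hf.smooth hα x i]
    exact (coord_pred (n := n - 1) i h).add ((hf.dquot α).const_mul _)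

lemma extLap {R : Finset (E d)} (hR0 : ∀ α ∈ R, α ≠ 0) (k : E d → ℝ) (h : IsPol n f) :
    IsPol (n - 2) (extLap R k f) :=
  (sum _ fun _ _ => (h.dd _).dd _).add
    (sum R fun α hα => (h.rootTerm (hR0 α hα)).const_mul (k α))

end IsPol

/-- The space of polynomials of degree less than `n`. -/
def polSubmodule (d n : ℕ) : Submodule ℝ (E d → ℝ) where
  carrier := {f | IsPol n f}
  add_mem' := fun hf hg => IsPol.add hf hg
  zero_mem' := IsPol.zero n
  smul_mem' := fun c _ hf => IsPol.const_mul hf c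

instance (d n : ℕ) : FiniteDimensional ℝ (polSubmodule d n) := by
  induction n with
  | zero =>
    have : polSubmodule d 0 = ⊥ := (Submodule.eq_bot_iff _).2 fun f hf => IsPol.eq_zero hf
    rw [this]
    infer_instance
  | succ n ih =>
    let M : Fin d → (E d → ℝ) →ₗ[ℝ] (E d → ℝ) := fun i => LinearMap.mulLeft ℝ (fun x : E d => x i)
    let S : Submodule ℝ (E d → ℝ) :=
      Submodule.span ℝ {fun _ => 1} ⊔ ⨆ i, (polSubmodule d n).map (M i)
    have hle : polSubmodule d (n + 1) ≤ S := by
      have key : ∀ m (f : E d → ℝ), IsPol m f → m = n + 1 → f ∈ S := by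
        intro m f h
        induction h with
        | zero => intro _; exact S.zero_mem
        | const m c =>
          intro _
          refine Submodule.mem_sup_left (Submodule.mem_span_singleton.2 ⟨c, ?_⟩)
          funext x
          simp
        | add _ _ h1 h2 => intro h; exact S.add_mem (h1 h) (h2 h)
        | coord i hf _ =>
          intro h
          obtain rfl : _ = n := Nat.succ_injective h
          exact Submodule.mem_sup_right (Submodule.mem_iSup_of_mem i ⟨_, hf, rfl⟩)
      exact fun f hf => key _ f hf rfl
    exact Submodule.finiteDimensional_of_le hle

section Radial

variable {d : ℕ} {θ : ℝ → ℝ} {p : E d → ℝ}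

lemma smooth_radial (hθ : ContDiff ℝ (⊤ : ℕ∞) θ) (c : ℝ) :
    Smooth (fun x : E d => θ (c - ‖x‖ ^ 2)) :=
  hθ.comp (contDiff_const.sub (contDiff_norm_sq ℝ))

lemma smooth_inner (a : E d) : Smooth (fun x : E d => ⟪a, x⟫) :=
  contDiff_const.inner ℝ contDiff_id

lemma dd_inner (a b : E d) : dd a (fun x : E d => ⟪b, x⟫) = fun _ => ⟪b, a⟫ := by
  funext x
  have h : HasFDerivAt (fun x : E d => ⟪b, x⟫) (innerSL ℝ b) x := (innerSL ℝ b).hasFDerivAt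
  simp [dd, h.fderiv]

lemma contDiff_deriv (hθ : ContDiff ℝ (⊤ : ℕ∞) θ) : ContDiff ℝ (⊤ : ℕ∞) (deriv θ) :=
  (contDiff_infty_iff_deriv.1 hθ).2

lemma dd_radial (hθ : ContDiff ℝ (⊤ : ℕ∞) θ) (c : ℝ) (a : E d) :
    dd a (fun x : E d => θ (c - ‖x‖ ^ 2)) =
      fun x => (-2 * ⟪a, x⟫) * deriv θ (c - ‖x‖ ^ 2) := by
  funext x
  have h1 : HasDerivAt θ (deriv θ (c - ‖x‖ ^ 2)) (c - ‖x‖ ^ 2) :=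
    (hθ.differentiable (by simp) _).hasDerivAt
  have h2 : HasFDerivAt (fun x : E d => c - ‖x‖ ^ 2) (-(2 • innerSL ℝ x)) x :=
    ((hasStrictFDerivAt_norm_sq x).hasFDerivAt).const_sub c
  have h3 := h1.comp_hasFDerivAt x h2
  change fderiv ℝ (θ ∘ fun x : E d => c - ‖x‖ ^ 2) x a = _
  rw [h3.fderiv]
  simp [real_inner_comm]
  ring

lemma dd_dd_radial (hθ : ContDiff ℝ (⊤ : ℕ∞) θ) (c : ℝ) (a : E d) :
    dd a (dd a (fun x : E d => θ (c - ‖x‖ ^ 2))) =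
      fun x => 4 * ⟪a, x⟫ ^ 2 * deriv (deriv θ) (c - ‖x‖ ^ 2)
        - 2 * ‖a‖ ^ 2 * deriv θ (c - ‖x‖ ^ 2) := by
  rw [dd_radial hθ, dd_mul (contDiff_const.mul (smooth_inner a))
    (smooth_radial (contDiff_deriv hθ) c), dd_const_mul (smooth_inner a), dd_inner,
    dd_radial (contDiff_deriv hθ)]
  funext x
  rw [real_inner_self_eq_norm_sq]
  ring

lemma rootTerm_radial_mul (hθ : ContDiff ℝ (⊤ : ℕ∞) θ) (c : ℝ) (hp : Smooth p) {α : E d}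
    (hα : α ≠ 0) (x : E d) :
    rootTerm α (fun x => θ (c - ‖x‖ ^ 2) * p x) x =
      θ (c - ‖x‖ ^ 2) * rootTerm α p x - 2 * deriv θ (c - ‖x‖ ^ 2) * p x := by
  have hn : ‖α‖ ≠ 0 := norm_ne_zero_iff.2 hα
  simp only [rootTerm]
  rw [dd_dd_mul (smooth_radial hθ c) hp, dd_mul (smooth_radial hθ c) hp, dd_dd_radial hθ,
    dd_radial hθ, norm_dunklReflect]
  split_ifs with h
  · simp only [h]
    field_simp
    ring
  · field_simp
    ring

lemma sumLap_radial_mul (hθ : ContDiff ℝ (⊤ : ℕ∞) θ) (c : ℝ) (hp : Smooth p) (x : E d) :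
    sumLap (fun x => θ (c - ‖x‖ ^ 2) * p x) x =
      θ (c - ‖x‖ ^ 2) * sumLap p x
        + deriv θ (c - ‖x‖ ^ 2) *
          (-2 * d * p x - 4 * ∑ i, x i * dd (EuclideanSpace.single i 1) p x)
        + deriv (deriv θ) (c - ‖x‖ ^ 2) * (4 * ‖x‖ ^ 2 * p x) := by
  have h : ∀ i : Fin d, dd (EuclideanSpace.single i 1) (dd (EuclideanSpace.single i 1)
      (fun x => θ (c - ‖x‖ ^ 2) * p x)) x =
      θ (c - ‖x‖ ^ 2) * dd (EuclideanSpace.single i 1) (dd (EuclideanSpace.single i 1) p) x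
        + deriv θ (c - ‖x‖ ^ 2) * (-2 * p x - 4 * (x i * dd (EuclideanSpace.single i 1) p x))
        + deriv (deriv θ) (c - ‖x‖ ^ 2) * (x i ^ 2 * (4 * p x)) := by
    intro i
    have h1 : ⟪EuclideanSpace.single i (1 : ℝ), x⟫ = x i := by
      simp [EuclideanSpace.inner_single_left]
    have h2 : ‖(EuclideanSpace.single i (1 : ℝ) : E d)‖ = 1 := by simp
    rw [dd_dd_mul (smooth_radial hθ c) hp, dd_dd_radial hθ, dd_radial hθ]
    simp only [h1, h2]
    ring
  have hx : ∑ i, x i ^ 2 = ‖x‖ ^ 2 := by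
    rw [EuclideanSpace.norm_sq_eq]
    simp
  simp only [sumLap, h, Finset.sum_add_distrib, ← Finset.mul_sum, ← Finset.sum_mul,
    Finset.sum_sub_distrib, Finset.sum_const, Finset.card_univ, Fintype.card_fin, nsmul_eq_mul, hx]
  ring

lemma extLap_radial_mul {R : Finset (E d)} (hR0 : ∀ α ∈ R, α ≠ 0) (k : E d → ℝ)
    (hθ : ContDiff ℝ (⊤ : ℕ∞) θ) (c : ℝ) (hp : Smooth p) (x : E d) :
    extLap R k (fun x => θ (c - ‖x‖ ^ 2) * p x) x =
      θ (c - ‖x‖ ^ 2) * extLap R k p x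
        + deriv θ (c - ‖x‖ ^ 2) * (-2 * (d + ∑ α ∈ R, k α) * p x
          - 4 * ∑ i, x i * dd (EuclideanSpace.single i 1) p x)
        + deriv (deriv θ) (c - ‖x‖ ^ 2) * (4 * ‖x‖ ^ 2 * p x) := by
  simp only [extLap]
  rw [sumLap_radial_mul hθ c hp]
  have h : ∑ α ∈ R, k α * rootTerm α (fun x => θ (c - ‖x‖ ^ 2) * p x) x =
      θ (c - ‖x‖ ^ 2) * ∑ α ∈ R, k α * rootTerm α p x
        - 2 * deriv θ (c - ‖x‖ ^ 2) * p x * ∑ α ∈ R, k α := by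
    rw [Finset.mul_sum, Finset.mul_sum, ← Finset.sum_sub_distrib]
    refine Finset.sum_congr rfl fun α hα => ?_
    rw [rootTerm_radial_mul hθ c hp (hR0 α hα)]
    ring
  rw [h]
  ring

lemma extLap_norm_sq {R : Finset (E d)} (hR0 : ∀ α ∈ R, α ≠ 0) (k : E d → ℝ) (x : E d) :
    extLap R k (fun x => ‖x‖ ^ 2) x = 2 * (d + ∑ α ∈ R, k α) := by
  have h := extLap_radial_mul hR0 k (θ := fun t => -t) contDiff_neg 0
    (p := fun _ => 1) contDiff_const x
  have h0 : extLap R k (fun _ => (1 : ℝ)) x = 0 := by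
    simp [extLap, sumLap, dd_const, rootTerm_const]
  have hd : deriv (fun t : ℝ => -t) = fun _ => -1 := by
    funext t; exact (hasDerivAt_neg t).deriv
  rw [h0, hd] at h
  simp only [dd_const] at h
  simpa using h

end Radial

section MaximumPrinciple

variable {d : ℕ} {f : E d → ℝ} {R : Finset (E d)} {k : E d → ℝ} {r : ℝ}

lemma extLap_nonpos_of_isMax (hkpos : ∀ α ∈ R, 0 < k α) (hf : Smooth f) {x : E d}
    (hx : x ∈ Metric.ball (0 : E d) r) (hmax : ∀ y ∈ Metric.closedBall (0 : E d) r, f y ≤ f x) :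
    extLap R k f x ≤ 0 := by
  have hloc : IsLocalMax f x := by
    filter_upwards [Metric.isOpen_ball.mem_nhds hx] with y hy
    exact hmax y (Metric.ball_subset_closedBall hy)
  have h1 : sumLap f x ≤ 0 :=
    Finset.sum_nonpos fun i _ => dd_dd_nonpos_of_isLocalMax hf hloc _
  have h2 : ∑ α ∈ R, k α * rootTerm α f x ≤ 0 := by
    refine Finset.sum_nonpos fun α hα => mul_nonpos_of_nonneg_of_nonpos (hkpos α hα).le ?_
    rw [rootTerm]
    split_ifs with h
    · exact div_nonpos_of_nonpos_of_nonneg (dd_dd_nonpos_of_isLocalMax hf hloc _) (by positivity)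
    · rw [dd_eq_zero_of_isLocalMax hloc]
      have h3 : f (dunklReflect α x) ≤ f x := by
        apply hmax
        rw [mem_closedBall_zero_iff, norm_dunklReflect]
        exact (mem_ball_zero_iff.1 hx).le
      have h4 : 0 ≤ (‖α‖ ^ 2 / 2) * ((f x - f (dunklReflect α x)) / ⟪α, x⟫ ^ 2) := by
        have := sub_nonneg.2 h3
        positivity
      simp only [zero_div]
      linarith
  unfold extLap
  linarith

lemma le_of_neg_le_extLap (hR0 : ∀ α ∈ R, α ≠ 0) (hkpos : ∀ α ∈ R, 0 < k α)
    (hm : 2 < (d : ℝ) + ∑ α ∈ R, k α) (hf : Smooth f) {A C : ℝ} (hC : 0 < C)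
    (hL : ∀ x ∈ Metric.ball (0 : E d) r, -C ≤ extLap R k f x)
    (hA : ∀ x ∈ Metric.sphere (0 : E d) r, f x ≤ A) {x : E d}
    (hx : x ∈ Metric.closedBall (0 : E d) r) : f x ≤ A + C * r ^ 2 := by
  have hsq : Smooth (fun x : E d => C * ‖x‖ ^ 2) := contDiff_const.mul (contDiff_norm_sq ℝ)
  have hF : Smooth (fun x => f x + C * ‖x‖ ^ 2) := hf.add hsq
  obtain ⟨y, hy, hmax⟩ := (isCompact_closedBall (0 : E d) r).exists_isMaxOn ⟨x, hx⟩
    hF.continuous.continuousOn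
  have hle := hmax hx
  simp only [Set.mem_ofPred_eq] at hle
  have hyr : ‖y‖ ≤ r := mem_closedBall_zero_iff.1 hy
  rcases hyr.lt_or_eq with h | h
  · have h1 := extLap_nonpos_of_isMax hkpos hF (mem_ball_zero_iff.2 h) hmax
    rw [extLap_add R k hf hsq, extLap_const_mul R k (contDiff_norm_sq ℝ), extLap_norm_sq hR0] at h1
    have h2 := hL y (mem_ball_zero_iff.2 h)
    nlinarith
  · have h1 := hA y (mem_sphere_zero_iff_norm.2 h)
    rw [h] at hle
    have : 0 ≤ C * ‖x‖ ^ 2 := by positivity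
    linarith

end MaximumPrinciple

/-- A smooth approximation of the weight `w_k`. -/
def regWeight {d : ℕ} (R : Finset (E d)) (k : E d → ℝ) (ε : ℝ) (x : E d) : ℝ :=
  Real.exp (∑ α ∈ R, k α / 2 * Real.log (⟪α, x⟫ ^ 2 + ε))

/-- The approximation of the Dunkl Laplacian that is symmetric with respect to `regWeight`. -/
def regLap {d : ℕ} (R : Finset (E d)) (k : E d → ℝ) (ε : ℝ) (f : E d → ℝ) (x : E d) : ℝ :=
  sumLap f x + ∑ α ∈ R, k α * (⟪α, x⟫ ^ 2 / (⟪α, x⟫ ^ 2 + ε) * rootTerm α f x)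

section Regularized

variable {d : ℕ} {R : Finset (E d)} {k : E d → ℝ} {ε : ℝ} {A C F : E d → ℝ}

lemma regWeight_pos (x : E d) : 0 < regWeight R k ε x := Real.exp_pos _

lemma smooth_regWeight_exponent (hε : 0 < ε) :
    Smooth (fun x : E d => ∑ α ∈ R, k α / 2 * Real.log (⟪α, x⟫ ^ 2 + ε)) := by
  refine ContDiff.sum fun α _ => contDiff_const.mul (ContDiff.log ?_ fun x => by positivity)
  exact ((smooth_inner α).pow 2).add contDiff_const

lemma smooth_regWeight (hε : 0 < ε) : Smooth (regWeight R k ε) :=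
  (smooth_regWeight_exponent hε).exp

lemma dd_regWeight (hε : 0 < ε) (a x : E d) :
    dd a (regWeight R k ε) x =
      regWeight R k ε x * ∑ α ∈ R, k α * (⟪α, x⟫ / (⟪α, x⟫ ^ 2 + ε)) * ⟪α, a⟫ := by
  have h0 : ∀ α : E d, HasFDerivAt (fun x : E d => ⟪α, x⟫) (innerSL ℝ α) x :=
    fun α => (innerSL ℝ α).hasFDerivAt
  have h1 := (HasFDerivAt.fun_sum (u := R) fun α _ =>
    (((((h0 α).pow 2).add_const ε).log (by positivity)).const_mul (k α / 2))).exp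
  change fderiv ℝ (fun x => Real.exp (∑ α ∈ R, k α / 2 * Real.log (⟪α, x⟫ ^ 2 + ε))) x a = _
  rw [h1.fderiv]
  simp only [smul_apply, sum_apply, smul_eq_mul,
    innerSL_apply_apply, regWeight]
  congr 1
  refine Finset.sum_congr rfl fun α _ => ?_
  simp
  ring

lemma regWeight_dunklReflect (hRrefl : ∀ α ∈ R, ∀ β ∈ R, dunklReflect α β ∈ R)
    (hkinv : ∀ α ∈ R, ∀ β ∈ R, k (dunklReflect α β) = k β) {β : E d} (hβ : β ∈ R) (x : E d) :
    regWeight R k ε (dunklReflect β x) = regWeight R k ε x := by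
  unfold regWeight
  congr 1
  refine Finset.sum_nbij' (dunklReflect β) (dunklReflect β) (hRrefl β hβ) (hRrefl β hβ)
    (fun α _ => dunklReflect_dunklReflect β α) (fun α _ => dunklReflect_dunklReflect β α) ?_
  intro α hα
  rw [hkinv β hβ α hα, inner_dunklReflect_left]

lemma regWeight_le (hkpos : ∀ α ∈ R, 0 < k α) (hε : 0 < ε) (hε1 : ε ≤ 1) (x : E d) :
    regWeight R k ε x ≤ regWeight R k 1 x := by
  refine Real.exp_le_exp.2 (Finset.sum_le_sum fun α hα => ?_)
  have := hkpos α hα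
  gcongr

lemma dd_eq_sum (f : E d → ℝ) (a x : E d) :
    dd a f x = ∑ i, a i * dd (EuclideanSpace.single i 1) f x := by
  have : a = ∑ i, a i • EuclideanSpace.single i (1 : ℝ) := by
    ext j
    simp [Finset.sum_apply, Pi.single_apply]
  simp only [dd]
  conv_lhs => rw [this]
  simp

lemma rootTerm_reg (hε : 0 < ε) (f : E d → ℝ) (α x : E d) :
    ⟪α, x⟫ ^ 2 / (⟪α, x⟫ ^ 2 + ε) * rootTerm α f x =
      ⟪α, x⟫ / (⟪α, x⟫ ^ 2 + ε) * dd α f x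
        - ‖α‖ ^ 2 / 2 * ((f x - f (dunklReflect α x)) / (⟪α, x⟫ ^ 2 + ε)) := by
  have h1 : ⟪α, x⟫ ^ 2 + ε ≠ 0 := by positivity
  rw [rootTerm]
  split_ifs with h
  · simp [h, dunklReflect_of_inner_eq_zero h]
  · field_simp

lemma sum_dd_regWeight_mul (hε : 0 < ε) (hC : Smooth C) (x : E d) :
    ∑ i : Fin d, dd (EuclideanSpace.single i 1)
      (fun y => regWeight R k ε y * dd (EuclideanSpace.single i 1) C y) x =
      regWeight R k ε x * (sumLap C x +
        ∑ α ∈ R, k α * (⟪α, x⟫ / (⟪α, x⟫ ^ 2 + ε) * dd α C x)) := by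
  have h : ∀ (α : E d) (i : Fin d), ⟪α, EuclideanSpace.single i (1 : ℝ)⟫ = α i := fun α i => by
    simp [EuclideanSpace.inner_single_right]
  simp only [dd_mul (smooth_regWeight hε) (hC.dd _), dd_regWeight hε, h]
  have hd : ∀ α ∈ R, k α * (⟪α, x⟫ / (⟪α, x⟫ ^ 2 + ε) * dd α C x) =
      ∑ i, k α * (⟪α, x⟫ / (⟪α, x⟫ ^ 2 + ε)) * (α i * dd (EuclideanSpace.single i 1) C x) := by
    intro α _
    rw [dd_eq_sum C α x, Finset.mul_sum, Finset.mul_sum]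
    exact Finset.sum_congr rfl fun i _ => by ring
  rw [Finset.sum_congr rfl hd, Finset.sum_comm, sumLap, ← Finset.sum_add_distrib, Finset.mul_sum]
  refine Finset.sum_congr rfl fun i _ => ?_
  rw [mul_add, mul_assoc, Finset.sum_mul]
  congr 2
  exact Finset.sum_congr rfl fun α _ => by ring

lemma regLap_eq (hε : 0 < ε) (hC : Smooth C) (x : E d) :
    regLap R k ε C x * regWeight R k ε x =
      ∑ i : Fin d, dd (EuclideanSpace.single i 1)
        (fun y => regWeight R k ε y * dd (EuclideanSpace.single i 1) C y) x
      - ∑ α ∈ R, k α * (‖α‖ ^ 2 / 2) * ((C x - C (dunklReflect α x)) *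
        (regWeight R k ε x / (⟪α, x⟫ ^ 2 + ε))) := by
  rw [sum_dd_regWeight_mul hε hC, regLap]
  have h1 : ∀ α ∈ R, k α * (⟪α, x⟫ ^ 2 / (⟪α, x⟫ ^ 2 + ε) * rootTerm α C x) * regWeight R k ε x =
      regWeight R k ε x * (k α * (⟪α, x⟫ / (⟪α, x⟫ ^ 2 + ε) * dd α C x)) -
        k α * (‖α‖ ^ 2 / 2) * ((C x - C (dunklReflect α x)) *
          (regWeight R k ε x / (⟪α, x⟫ ^ 2 + ε))) := by
    intro α _
    rw [rootTerm_reg hε]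
    ring
  rw [add_mul, Finset.sum_mul, Finset.sum_congr rfl h1, Finset.sum_sub_distrib, mul_add,
    Finset.mul_sum]
  ring

lemma integral_mul_dd (hA : Smooth A) (hC : Smooth C)
    (hc : HasCompactSupport A ∨ HasCompactSupport C) (a : E d) :
    ∫ x, A x * dd a C x = -∫ x, dd a A x * C x := by
  have hsA : HasCompactSupport A → HasCompactSupport (dd a A) := fun h => h.fderiv_apply ℝ a
  have hsC : HasCompactSupport C → HasCompactSupport (dd a C) := fun h => h.fderiv_apply ℝ a
  refine integral_mul_fderiv_eq_neg_fderiv_mul_of_integrable ?_ ?_ ?_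
    (fun x _ => hA.differentiable x) (fun x _ => hC.differentiable x)
  · exact ((hA.dd a).continuous.mul hC.continuous).integrable_of_hasCompactSupport
      (hc.elim (fun h => (hsA h).mul_right) fun h => h.mul_left)
  · exact (hA.continuous.mul (hC.dd a).continuous).integrable_of_hasCompactSupport
      (hc.elim (fun h => h.mul_right) fun h => (hsC h).mul_left)
  · exact (hA.continuous.mul hC.continuous).integrable_of_hasCompactSupport
      (hc.elim (fun h => h.mul_right) fun h => h.mul_left)

lemma integral_mul_dd_mul_dd (hA : Smooth A) (hC : Smooth C) (hF : Smooth F)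
    (hc : HasCompactSupport C) (a : E d) :
    ∫ x, A x * dd a (fun y => F y * dd a C y) x = ∫ x, C x * dd a (fun y => F y * dd a A y) x := by
  have hsC : HasCompactSupport (dd a C) := hc.fderiv_apply ℝ a
  rw [integral_mul_dd hA (hF.mul (hC.dd a)) (Or.inr hsC.mul_left),
    integral_mul_dd hC (hF.mul (hA.dd a)) (Or.inl hc)]
  congr 2
  funext x
  ring

lemma integral_mul_sub_dunklReflect (hA : Continuous A) (hC : Continuous C) (hF : Continuous F)
    (hc : HasCompactSupport C) (α : E d) (hFα : ∀ x, F (dunklReflect α x) = F x) :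
    ∫ x, A x * ((C x - C (dunklReflect α x)) * F x) =
      ∫ x, C x * ((A x - A (dunklReflect α x)) * F x) := by
  have hσ : Continuous (dunklReflect α) := (smooth_dunklReflect α).continuous
  have hg : Continuous (fun x => A (dunklReflect α x) * C x * F x) := by fun_prop
  have hgc : HasCompactSupport (fun x => A (dunklReflect α x) * C x * F x) :=
    hc.mul_left.mul_right
  have hgi : Integrable (fun x => A (dunklReflect α x) * C x * F x) :=
    hg.integrable_of_hasCompactSupport hgc
  have h0 : Integrable (fun x => A x * C x * F x) :=
    Continuous.integrable_of_hasCompactSupport (by fun_prop) hc.mul_left.mul_right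
  have hmp := measurePreserving_dunklReflect α
  have hme := measurableEmbedding_dunklReflect α
  have heq : ∀ x, A (dunklReflect α (dunklReflect α x)) * C (dunklReflect α x) *
      F (dunklReflect α x) = A x * C (dunklReflect α x) * F x := fun x => by
    rw [dunklReflect_dunklReflect, hFα]
  have h1 : Integrable (fun x => A x * C (dunklReflect α x) * F x) := by
    simpa only [Function.comp_def, heq] using (hmp.integrable_comp_emb hme).2 hgi
  have h2 : ∫ x, A x * C (dunklReflect α x) * F x = ∫ x, A (dunklReflect α x) * C x * F x := by
    simpa only [heq] using
      hmp.integral_comp hme (fun x => A (dunklReflect α x) * C x * F x)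
  calc ∫ x, A x * ((C x - C (dunklReflect α x)) * F x)
      = ∫ x, (A x * C x * F x - A x * C (dunklReflect α x) * F x) := by congr 1; funext x; ring
    _ = ∫ x, (A x * C x * F x - A (dunklReflect α x) * C x * F x) := by
        rw [integral_sub h0 h1, integral_sub h0 hgi, h2]
    _ = _ := by congr 1; funext x; ring

lemma integral_regLap_comm (hRrefl : ∀ α ∈ R, ∀ β ∈ R, dunklReflect α β ∈ R)
    (hkinv : ∀ α ∈ R, ∀ β ∈ R, k (dunklReflect α β) = k β) (hR0 : ∀ α ∈ R, α ≠ 0)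
    (hε : 0 < ε) (hA : Smooth A) (hC : Smooth C) (hc : HasCompactSupport C) :
    ∫ x, A x * (regLap R k ε C x * regWeight R k ε x) =
      ∫ x, C x * (regLap R k ε A x * regWeight R k ε x) := by
  simp only [regLap_eq hε hA, regLap_eq hε hC, mul_sub, Finset.mul_sum]
  have hw : Smooth (regWeight R k ε) := smooth_regWeight hε
  have hsC : ∀ a, HasCompactSupport (dd a C) := fun a => hc.fderiv_apply ℝ a
  have hF : ∀ α : E d, Continuous (fun x => regWeight R k ε x / (⟪α, x⟫ ^ 2 + ε)) := fun α =>
    hw.continuous.div (by fun_prop) fun x => by positivity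
  have hσ : ∀ α : E d, Continuous (dunklReflect α) := fun α => (smooth_dunklReflect α).continuous
  have hCσ : ∀ α : E d, HasCompactSupport (fun x => C (dunklReflect α x)) := fun α => by
    rw [dunklReflect_eq_reflection]
    exact hc.comp_homeomorph (ℝ ∙ α)ᗮ.reflection.toHomeomorph
  have i1 : ∀ i : Fin d, Integrable (fun x => A x * dd (EuclideanSpace.single i 1)
      (fun y => regWeight R k ε y * dd (EuclideanSpace.single i 1) C y) x) := fun i =>
    (hA.continuous.mul (Smooth.dd (hw.mul (hC.dd _)) _).continuous).integrable_of_hasCompactSupport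
      (((hsC _).mul_left.fderiv_apply ℝ _).mul_left)
  have i2 : ∀ i : Fin d, Integrable (fun x => C x * dd (EuclideanSpace.single i 1)
      (fun y => regWeight R k ε y * dd (EuclideanSpace.single i 1) A y) x) := fun i =>
    (hC.continuous.mul (Smooth.dd (hw.mul (hA.dd _)) _).continuous).integrable_of_hasCompactSupport
      hc.mul_right
  have i3 : ∀ α : E d, Integrable (fun x => A x * (k α * (‖α‖ ^ 2 / 2) *
      ((C x - C (dunklReflect α x)) * (regWeight R k ε x / (⟪α, x⟫ ^ 2 + ε))))) := fun α => by
    have := hF α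
    have := hσ α
    have := hA.continuous
    have := hC.continuous
    refine Continuous.integrable_of_hasCompactSupport (by fun_prop) ?_
    exact (HasCompactSupport.mul_right (hc.sub (hCσ α))).mul_left.mul_left
  have i4 : ∀ α : E d, Integrable (fun x => C x * (k α * (‖α‖ ^ 2 / 2) *
      ((A x - A (dunklReflect α x)) * (regWeight R k ε x / (⟪α, x⟫ ^ 2 + ε))))) := fun α => by
    have := hF α
    have := hσ α
    have := hA.continuous
    have := hC.continuous
    exact Continuous.integrable_of_hasCompactSupport (by fun_prop) hc.mul_right
  rw [integral_sub (integrable_finsetSum _ fun i _ => i1 i)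
      (integrable_finsetSum _ fun α _ => i3 α),
    integral_sub (integrable_finsetSum _ fun i _ => i2 i)
      (integrable_finsetSum _ fun α _ => i4 α),
    integral_finsetSum _ fun i _ => i1 i, integral_finsetSum _ fun i _ => i2 i,
    integral_finsetSum _ fun α _ => i3 α, integral_finsetSum _ fun α _ => i4 α]
  congr 1
  · exact Finset.sum_congr rfl fun i _ => integral_mul_dd_mul_dd hA hC hw hc _
  · refine Finset.sum_congr rfl fun α hα => ?_
    have h := integral_mul_sub_dunklReflect hA.continuous hC.continuous (hF α) hc α fun x => by
      rw [regWeight_dunklReflect hRrefl hkinv hα, inner_dunklReflect_self α x (hR0 α hα), neg_sq]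
    simp only [mul_left_comm _ (k α * (‖α‖ ^ 2 / 2)), integral_const_mul, h]

end Regularized

section Symmetry

variable {d : ℕ} {R : Finset (E d)} {k : E d → ℝ} {A C : E d → ℝ}

lemma ae_inner_ne_zero (hR0 : ∀ α ∈ R, α ≠ 0) : ∀ᵐ x : E d, ∀ α ∈ R, ⟪α, x⟫ ≠ 0 := by
  refine (ae_ball_iff R.countable_toSet).2 fun α hα => ?_
  have h := Measure.addHaar_submodule (volume : Measure (E d)) (ℝ ∙ α)ᗮ (fun h => by
    have h1 : α ∈ (ℝ ∙ α)ᗮ := h ▸ Submodule.mem_top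
    have h2 := Submodule.mem_orthogonal_singleton_iff_inner_right.1 h1
    exact hR0 α hα (inner_self_eq_zero.1 h2))
  refine (measure_eq_zero_iff_ae_notMem.1 h).mono fun x hx h0 => hx ?_
  exact Submodule.mem_orthogonal_singleton_iff_inner_right.2 h0

lemma regWeight_zero {x : E d} (hx : ∀ α ∈ R, ⟪α, x⟫ ≠ 0) : regWeight R k 0 x = wk R k x := by
  rw [regWeight, wk, Real.exp_sum]
  refine Finset.prod_congr rfl fun α hα => ?_
  have h : ⟪x, α⟫ = ⟪α, x⟫ := real_inner_comm _ _
  rw [h, Real.rpow_def_of_pos (abs_pos.2 (hx α hα)), add_zero, Real.log_pow,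
    Real.log_abs]
  congr 1
  push_cast
  ring

lemma tendsto_regWeight {x : E d} (hx : ∀ α ∈ R, ⟪α, x⟫ ≠ 0) :
    Tendsto (fun ε => regWeight R k ε x) (𝓝[>] 0) (𝓝 (wk R k x)) := by
  rw [← regWeight_zero hx]
  refine (ContinuousAt.tendsto ?_).mono_left nhdsWithin_le_nhds
  refine ContinuousAt.rexp (tendsto_finsetSum _ fun α hα => ?_)
  have h : ⟪α, x⟫ ^ 2 + 0 ≠ 0 := by simpa using hx α hα
  exact (((continuous_const.add continuous_id).continuousAt (x := (0 : ℝ))).log h).const_mul _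

lemma tendsto_regLap {x : E d} (hx : ∀ α ∈ R, ⟪α, x⟫ ≠ 0) (f : E d → ℝ) :
    Tendsto (fun ε => regLap R k ε f x) (𝓝[>] 0) (𝓝 (extLap R k f x)) := by
  refine Tendsto.mono_left ?_ (nhdsWithin_le_nhds (a := (0 : ℝ)))
  refine tendsto_const_nhds.add (tendsto_finsetSum _ fun α hα => ?_)
  have h : ⟪α, x⟫ ^ 2 + 0 ≠ 0 := by simpa using hx α hα
  have h1 : Tendsto (fun ε => ⟪α, x⟫ ^ 2 / (⟪α, x⟫ ^ 2 + ε)) (𝓝 (0 : ℝ))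
      (𝓝 (⟪α, x⟫ ^ 2 / (⟪α, x⟫ ^ 2 + 0))) :=
    tendsto_const_nhds.div (tendsto_const_nhds.add tendsto_id) h
  rw [add_zero, div_self (by simpa using h)] at h1
  simpa using (h1.mul_const (rootTerm α f x)).const_mul (k α)

lemma abs_regLap_le (hkpos : ∀ α ∈ R, 0 < k α) {ε : ℝ} (hε : 0 < ε) (f : E d → ℝ) (x : E d) :
    |regLap R k ε f x| ≤ |sumLap f x| + ∑ α ∈ R, k α * |rootTerm α f x| := by
  refine (abs_add_le _ _).trans (add_le_add le_rfl ((Finset.abs_sum_le_sum_abs _ _).trans ?_))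
  refine Finset.sum_le_sum fun α hα => ?_
  have hk := hkpos α hα
  rw [abs_mul, abs_mul, abs_of_pos hk]
  have h1 : |⟪α, x⟫ ^ 2 / (⟪α, x⟫ ^ 2 + ε)| ≤ 1 := by
    rw [abs_of_nonneg (by positivity)]
    exact div_le_one_of_le₀ (by linarith) (by positivity)
  exact mul_le_mul_of_nonneg_left (mul_le_of_le_one_left (abs_nonneg _) h1) hk.le

lemma Smooth.sumLap_continuous {f : E d → ℝ} (hf : Smooth f) : Continuous (sumLap f) :=
  continuous_finsetSum _ fun _ _ => ((hf.dd _).dd _).continuous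

lemma dd_eq_zero_of_forall {f : E d → ℝ} {s : Set (E d)} (hs : IsOpen s) (h : ∀ x ∈ s, f x = 0)
    (a : E d) : ∀ x ∈ s, dd a f x = 0 := by
  intro x hx
  have : f =ᶠ[𝓝 x] fun _ => 0 := by
    filter_upwards [hs.mem_nhds hx] with y hy using h y hy
  simp [dd, this.fderiv_eq]

/-- Symmetry of the Dunkl Laplacian with respect to the weight `w_k`. -/
lemma integral_extLap_comm (hRrefl : ∀ α ∈ R, ∀ β ∈ R, dunklReflect α β ∈ R)
    (hkinv : ∀ α ∈ R, ∀ β ∈ R, k (dunklReflect α β) = k β) (hR0 : ∀ α ∈ R, α ≠ 0)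
    (hkpos : ∀ α ∈ R, 0 < k α) (hA : Smooth A) (hC : Smooth C)
    (hrA : ∀ α ∈ R, Continuous (rootTerm α A)) (hrC : ∀ α ∈ R, Continuous (rootTerm α C))
    {ρ : ℝ} (hρ : ∀ x, ρ < ‖x‖ → C x = 0) :
    ∫ x, A x * (extLap R k C x * wk R k x) = ∫ x, C x * (extLap R k A x * wk R k x) := by
  have hopen : IsOpen {x : E d | ρ < ‖x‖} := isOpen_lt continuous_const continuous_norm
  have hcs : ∀ {f : E d → ℝ}, (∀ x, ρ < ‖x‖ → f x = 0) → HasCompactSupport f := fun {f} hf =>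
    HasCompactSupport.intro (isCompact_closedBall (0 : E d) ρ) fun x hx => hf x (by
      simpa using hx)
  have hdC : ∀ a, ∀ x ∈ {x : E d | ρ < ‖x‖}, dd a C x = 0 := dd_eq_zero_of_forall hopen hρ
  have hddC : ∀ a, ∀ x ∈ {x : E d | ρ < ‖x‖}, dd a (dd a C) x = 0 := fun a =>
    dd_eq_zero_of_forall hopen (hdC a) a
  have hw1 : Continuous (regWeight R k 1) := (smooth_regWeight one_pos).continuous
  have key : ∀ {f g : E d → ℝ}, Smooth f → Smooth g → (∀ α ∈ R, Continuous (rootTerm α g)) →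
      (∀ x, ρ < ‖x‖ → f x * (|sumLap g x| + ∑ α ∈ R, k α * |rootTerm α g x|) = 0) →
      Tendsto (fun ε => ∫ x, f x * (regLap R k ε g x * regWeight R k ε x)) (𝓝[>] 0)
        (𝓝 (∫ x, f x * (extLap R k g x * wk R k x))) := by
    intro f g hf hg hr hz
    have hb : Continuous fun x => |sumLap g x| + ∑ α ∈ R, k α * |rootTerm α g x| :=
      hg.sumLap_continuous.abs.add
        (continuous_finsetSum _ fun α hα => continuous_const.mul (hr α hα).abs)
    refine tendsto_integral_filter_of_dominated_convergence
      (fun x => |f x * (|sumLap g x| + ∑ α ∈ R, k α * |rootTerm α g x|)| * regWeight R k 1 x)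
      ?_ ?_ ?_ ?_
    · filter_upwards [self_mem_nhdsWithin] with ε hε
      have hε : 0 < ε := hε
      refine Continuous.aestronglyMeasurable (hf.continuous.mul (Continuous.mul ?_
        (smooth_regWeight hε).continuous))
      refine hg.sumLap_continuous.add (continuous_finsetSum _ fun α hα =>
        continuous_const.mul (Continuous.mul ?_ (hr α hα)))
      exact Continuous.div (by fun_prop) (by fun_prop) fun x => by positivity
    · filter_upwards [Ioc_mem_nhdsGT one_pos] with ε hε
      refine Eventually.of_forall fun x => ?_
      rw [Real.norm_eq_abs, abs_mul, abs_mul, abs_mul, abs_of_pos (regWeight_pos x), mul_assoc]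
      refine mul_le_mul_of_nonneg_left (mul_le_mul ?_ (regWeight_le hkpos hε.1 hε.2 x)
        (regWeight_pos x).le (abs_nonneg _)) (abs_nonneg _)
      exact (abs_regLap_le hkpos hε.1 g x).trans (le_abs_self _)
    · exact Continuous.integrable_of_hasCompactSupport ((hf.continuous.mul hb).abs.mul hw1)
        (hcs fun x hx => by rw [hz x hx]; simp)
    · filter_upwards [ae_inner_ne_zero hR0] with x hx
      exact ((tendsto_regLap hx g).mul (tendsto_regWeight hx)).const_mul _
  have h1 := key hA hC hrC fun x hx => by
    have hs : sumLap C x = 0 := Finset.sum_eq_zero fun i _ => hddC _ x hx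
    have ht : ∑ α ∈ R, k α * |rootTerm α C x| = 0 := Finset.sum_eq_zero fun α _ => by
      have h2 : C (dunklReflect α x) = 0 := hρ _ (by rwa [norm_dunklReflect])
      simp [rootTerm, hdC α x hx, hddC α x hx, h2, hρ x hx]
    rw [hs, ht]
    simp
  have h2 := key hC hA hrA fun x hx => by rw [hρ x hx, zero_mul]
  refine tendsto_nhds_unique h1 (h2.congr' ?_)
  filter_upwards [self_mem_nhdsWithin] with ε hε
  exact (integral_regLap_comm hRrefl hkinv hR0 hε hA hC (hcs hρ)).symm

end Symmetry

section Dirichlet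

variable {d : ℕ} {R : Finset (E d)} {k : E d → ℝ} {r : ℝ}

lemma IsPol.norm_sq_mul {n : ℕ} {p : E d → ℝ} (hp : IsPol n p) :
    IsPol (n + 2) (fun x => ‖x‖ ^ 2 * p x) := by
  have h : (fun x : E d => ‖x‖ ^ 2 * p x) = fun x => ∑ i, x i * (x i * p x) := by
    funext x
    rw [← real_inner_self_eq_norm_sq, inner_eq_sum, Finset.sum_mul]
    exact Finset.sum_congr rfl fun i _ => by ring
  rw [h]
  exact IsPol.sum _ fun i _ => (hp.coord i).coord i

lemma IsPol.radius_mul {n : ℕ} {p : E d → ℝ} (hp : IsPol n p) (r : ℝ) :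
    IsPol (n + 2) (fun x => (r ^ 2 - ‖x‖ ^ 2) * p x) := by
  have h := ((hp.const_mul (r ^ 2)).mono (m := n + 2) (by omega)).add
    (hp.norm_sq_mul.const_mul (-1))
  convert h using 2
  ring

/-- The map `p ↦ Δ_k ((r² - |x|²) p)` on polynomials of bounded degree. -/
def dirichletMap (R : Finset (E d)) (k : E d → ℝ) (hR0 : ∀ α ∈ R, α ≠ 0) (r : ℝ) (n : ℕ) :
    polSubmodule d n →ₗ[ℝ] polSubmodule d n where
  toFun p := ⟨extLap R k fun x => (r ^ 2 - ‖x‖ ^ 2) * p.1 x,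
    ((IsPol.radius_mul p.2 r).extLap hR0 k : IsPol (n + 2 - 2) _)⟩
  map_add' p q := by
    refine Subtype.ext (funext fun x => ?_)
    have h := extLap_add R k (IsPol.radius_mul p.2 r).smooth (IsPol.radius_mul q.2 r).smooth x
    simp only [← mul_add] at h
    exact h
  map_smul' c p := by
    refine Subtype.ext (funext fun x => ?_)
    have h := extLap_const_mul R k (IsPol.radius_mul p.2 r).smooth c x
    simp only [mul_left_comm c] at h
    exact h

lemma dirichletMap_injective (hR0 : ∀ α ∈ R, α ≠ 0) (hkpos : ∀ α ∈ R, 0 < k α)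
    (hm : 2 < (d : ℝ) + ∑ α ∈ R, k α) (hr : 0 < r) (n : ℕ) :
    Function.Injective (dirichletMap R k hR0 r n) := by
  refine (injective_iff_map_eq_zero _).2 fun p hp => ?_
  have hpol : IsPol n p.1 := p.2
  have hs := (hpol.radius_mul r).smooth
  have h0 : ∀ x, extLap R k (fun x => (r ^ 2 - ‖x‖ ^ 2) * p.1 x) x = 0 := fun x =>
    congrFun (congrArg Subtype.val hp) x
  have hsph : ∀ x ∈ Metric.sphere (0 : E d) r, (r ^ 2 - ‖x‖ ^ 2) * p.1 x = 0 := fun x hx => by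
    rw [mem_sphere_zero_iff_norm.1 hx]; ring
  have hle : ∀ x ∈ Metric.closedBall (0 : E d) r, (r ^ 2 - ‖x‖ ^ 2) * p.1 x = 0 := by
    intro x hx
    have hr2 : 0 < r ^ 2 := by positivity
    refine le_antisymm (le_of_forall_pos_le_add fun ε hε => ?_)
      (le_of_forall_pos_le_add fun ε hε => ?_)
    · have h := le_of_neg_le_extLap hR0 hkpos hm hs (C := ε / r ^ 2) (A := 0) (by positivity)
        (fun y _ => by rw [h0]; have : 0 < ε / r ^ 2 := by positivity
                       linarith) (fun y hy => (hsph y hy).le) hx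
      rwa [div_mul_cancel₀ _ hr2.ne'] at h
    · have h := le_of_neg_le_extLap hR0 hkpos hm (((hpol.radius_mul r).const_mul (-1)).smooth)
        (C := ε / r ^ 2) (A := 0) (by positivity)
        (fun y _ => by rw [extLap_const_mul R k hs, h0]; have : 0 < ε / r ^ 2 := by positivity
                       linarith) (fun y hy => by rw [hsph y hy]; simp) hx
      rw [div_mul_cancel₀ _ hr2.ne'] at h
      linarith
  have hnear : p.1 =ᶠ[𝓝 0] fun _ => 0 := by
    filter_upwards [Metric.ball_mem_nhds (0 : E d) hr] with x hx
    have h1 := hle x (Metric.ball_subset_closedBall hx)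
    have h2 : ‖x‖ < r := mem_ball_zero_iff.1 hx
    have h3 : 0 < r ^ 2 - ‖x‖ ^ 2 := by nlinarith [norm_nonneg x]
    exact (mul_eq_zero.1 h1).resolve_left h3.ne'
  exact Subtype.ext (hpol.analytic.eq_of_eventuallyEq analyticOnNhd_const hnear)

lemma exists_isPol_extLap_radius_mul_eq (hR0 : ∀ α ∈ R, α ≠ 0) (hkpos : ∀ α ∈ R, 0 < k α)
    (hm : 2 < (d : ℝ) + ∑ α ∈ R, k α) (hr : 0 < r) {n : ℕ} {g : E d → ℝ} (hg : IsPol n g) :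
    ∃ p, IsPol n p ∧ ∀ x, extLap R k (fun x => (r ^ 2 - ‖x‖ ^ 2) * p x) x = g x := by
  obtain ⟨p, hp⟩ := LinearMap.injective_iff_surjective.1
    (dirichletMap_injective hR0 hkpos hm hr n) ⟨g, hg⟩
  exact ⟨p.1, p.2, congrFun (congrArg Subtype.val hp)⟩

/-- The Dirichlet problem on a ball centred at the origin, for polynomial data. -/
lemma exists_isPol_extLap_eq (hR0 : ∀ α ∈ R, α ≠ 0) (hkpos : ∀ α ∈ R, 0 < k α)
    (hm : 2 < (d : ℝ) + ∑ α ∈ R, k α) (hr : 0 < r) {m n : ℕ} {q g : E d → ℝ}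
    (hq : IsPol m q) (hg : IsPol n g) :
    ∃ N P, IsPol N P ∧ (∀ x, extLap R k P x = g x) ∧
      ∀ x ∈ Metric.sphere (0 : E d) r, P x = q x := by
  have hf : IsPol (max n m) (fun x => g x + (-1) * extLap R k q x) :=
    (hg.mono (le_max_left _ _)).add
      (((hq.extLap hR0 k).const_mul (-1)).mono ((Nat.sub_le _ _).trans (le_max_right _ _)))
  obtain ⟨p, hp, hpf⟩ := exists_isPol_extLap_radius_mul_eq hR0 hkpos hm hr hf
  have hrp := hp.radius_mul r
  refine ⟨_, _, (hq.mono (le_max_left _ (max n m + 2))).add (hrp.mono (le_max_right _ _)),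
    fun x => ?_, fun x hx => ?_⟩
  · rw [extLap_add R k hq.smooth hrp.smooth, hpf]
    ring
  · rw [mem_sphere_zero_iff_norm.1 hx]
    ring

/-- Uniform approximation by polynomials on a closed ball. -/
lemma exists_isPol_near {h : E d → ℝ} (hh : ContinuousOn h (Metric.closedBall (0 : E d) r))
    {ε : ℝ} (hε : 0 < ε) :
    ∃ n p, IsPol n p ∧ ∀ x ∈ Metric.closedBall (0 : E d) r, |p x - h x| < ε := by
  let K : Set (E d) := Metric.closedBall (0 : E d) r
  have hK : CompactSpace K := isCompact_iff_compactSpace.1 (isCompact_closedBall _ _)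
  let A : Subalgebra ℝ C(K, ℝ) :=
    { carrier := {F | ∃ (n : ℕ) (p : E d → ℝ), IsPol n p ∧ ∀ x : K, F x = p x}
      mul_mem' := by
        rintro F G ⟨n, p, hp, hFp⟩ ⟨m, q, hq, hGq⟩
        exact ⟨_, _, hp.mul hq, fun x => by simp [hFp, hGq]⟩
      add_mem' := by
        rintro F G ⟨n, p, hp, hFp⟩ ⟨m, q, hq, hGq⟩
        exact ⟨_, _, (hp.mono (le_max_left n m)).add (hq.mono (le_max_right n m)),
          fun x => by simp [hFp, hGq]⟩
      algebraMap_mem' := fun c => ⟨_, _, IsPol.const 0 c, fun x => by simp⟩ }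
  have hA : A.SeparatesPoints := by
    intro x y hxy
    have : ∃ i, (x : E d) i ≠ (y : E d) i := by
      by_contra! hc
      exact hxy (Subtype.ext (PiLp.ext hc))
    obtain ⟨i, hi⟩ := this
    refine ⟨_, ⟨⟨fun z : K => (z : E d) i, by fun_prop⟩,
      ⟨_, _, (IsPol.const 0 1).coord i, fun z => by simp⟩, rfl⟩, hi⟩
  obtain ⟨⟨F, n, p, hp, hFp⟩, hF⟩ :=
    ContinuousMap.exists_mem_subalgebra_near_continuous_of_separatesPoints A hA
      (K.domRestrict h) hh.domRestrict ε hε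
  refine ⟨n, p, hp, fun x hx => ?_⟩
  have := hF ⟨x, hx⟩
  simpa [hFp] using this

end Dirichlet

section Cutoff

/-- A smooth function vanishing on `(-∞, 1]` and equal to the identity on `[2, ∞)`. -/
def cutoff (s : ℝ) : ℝ := s * Real.smoothTransition (s - 1)

lemma contDiff_cutoff : ContDiff ℝ (⊤ : ℕ∞) cutoff :=
  contDiff_id.mul (Real.smoothTransition.contDiff.comp (contDiff_id.sub contDiff_const))

lemma cutoff_of_le {s : ℝ} (hs : s ≤ 1) : cutoff s = 0 := by
  rw [cutoff, Real.smoothTransition.zero_of_nonpos (by linarith), mul_zero]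

lemma cutoff_of_ge {s : ℝ} (hs : 2 ≤ s) : cutoff s = s := by
  rw [cutoff, Real.smoothTransition.one_of_one_le (by linarith), mul_one]

lemma deriv_cutoff_of_gt {s : ℝ} (hs : 2 < s) : deriv cutoff s = 1 := by
  have : cutoff =ᶠ[𝓝 s] id := by
    filter_upwards [Ioi_mem_nhds hs] with t ht using cutoff_of_ge (le_of_lt ht)
  rw [this.deriv_eq, deriv_id]

lemma deriv_deriv_cutoff_of_gt {s : ℝ} (hs : 2 < s) : deriv (deriv cutoff) s = 0 := by
  have : deriv cutoff =ᶠ[𝓝 s] fun _ => 1 := by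
    filter_upwards [Ioi_mem_nhds hs] with t ht using deriv_cutoff_of_gt ht
  rw [this.deriv_eq, deriv_const]

/-- The rescaled cut-off `δ Θ(t / δ)`. -/
def scaledCutoff (δ t : ℝ) : ℝ := δ * cutoff (δ⁻¹ * t)

lemma contDiff_scaledCutoff (δ : ℝ) : ContDiff ℝ (⊤ : ℕ∞) (scaledCutoff δ) :=
  contDiff_const.mul (contDiff_cutoff.comp (contDiff_const.mul contDiff_id))

lemma deriv_scaledCutoff {δ : ℝ} (hδ : δ ≠ 0) :
    deriv (scaledCutoff δ) = fun t => deriv cutoff (δ⁻¹ * t) := by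
  funext t
  unfold scaledCutoff
  rw [deriv_const_mul_field, deriv_comp_mul_left, smul_eq_mul, mul_inv_cancel_left₀ hδ]

lemma deriv_deriv_scaledCutoff {δ : ℝ} (hδ : δ ≠ 0) :
    deriv (deriv (scaledCutoff δ)) = fun t => δ⁻¹ * deriv (deriv cutoff) (δ⁻¹ * t) := by
  funext t
  rw [deriv_scaledCutoff hδ, deriv_comp_mul_left, smul_eq_mul]

lemma scaledCutoff_of_le {δ t : ℝ} (hδ : 0 < δ) (ht : t ≤ δ) : scaledCutoff δ t = 0 := by
  rw [scaledCutoff, cutoff_of_le, mul_zero]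
  rw [inv_mul_le_iff₀ hδ]
  linarith

lemma scaledCutoff_of_gt {δ t : ℝ} (hδ : 0 < δ) (ht : 2 * δ < t) :
    scaledCutoff δ t = t ∧ deriv (scaledCutoff δ) t = 1 ∧ deriv (deriv (scaledCutoff δ)) t = 0 := by
  have h : 2 < δ⁻¹ * t := by
    rw [lt_inv_mul_iff₀ hδ]
    linarith
  rw [deriv_deriv_scaledCutoff hδ.ne', deriv_scaledCutoff hδ.ne']
  simp only [scaledCutoff, cutoff_of_ge h.le, deriv_cutoff_of_gt h, deriv_deriv_cutoff_of_gt h,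
    mul_inv_cancel_left₀ hδ.ne', mul_zero, and_self]

lemma exists_scaledCutoff_bound : ∃ M, 0 < M ∧ ∀ δ t : ℝ, 0 < δ → δ ≤ 1 → 0 ≤ t → t ≤ 2 * δ →
    |t - scaledCutoff δ t| ≤ M / δ ∧ |1 - deriv (scaledCutoff δ) t| ≤ M / δ ∧
      |deriv (deriv (scaledCutoff δ)) t| ≤ M / δ := by
  have hc := contDiff_cutoff
  have hc1 := contDiff_deriv hc
  have hc2 := contDiff_deriv hc1
  obtain ⟨M0, h0⟩ := (isCompact_Icc (a := (0 : ℝ)) (b := 2)).exists_bound_of_continuousOn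
    (continuous_id.sub hc.continuous).continuousOn
  obtain ⟨M1, h1⟩ := (isCompact_Icc (a := (0 : ℝ)) (b := 2)).exists_bound_of_continuousOn
    (continuous_const.sub hc1.continuous : Continuous fun t => 1 - deriv cutoff t).continuousOn
  obtain ⟨M2, h2⟩ := (isCompact_Icc (a := (0 : ℝ)) (b := 2)).exists_bound_of_continuousOn
    hc2.continuous.continuousOn
  refine ⟨|M0| + |M1| + |M2| + 1, by positivity, fun δ t hδ hδ1 ht ht2 => ?_⟩
  have hs : δ⁻¹ * t ∈ Set.Icc (0 : ℝ) 2 :=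
    ⟨by positivity, by rw [inv_mul_le_iff₀ hδ]; linarith⟩
  have h0 : |δ⁻¹ * t - cutoff (δ⁻¹ * t)| ≤ M0 := h0 _ hs
  have h1 : |1 - deriv cutoff (δ⁻¹ * t)| ≤ M1 := h1 _ hs
  have h2 : |deriv (deriv cutoff) (δ⁻¹ * t)| ≤ M2 := h2 _ hs
  have a0 := le_abs_self M0
  have a1 := le_abs_self M1
  have a2 := le_abs_self M2
  have b0 := abs_nonneg M0
  have b1 := abs_nonneg M1
  have b2 := abs_nonneg M2
  rw [deriv_deriv_scaledCutoff hδ.ne', deriv_scaledCutoff hδ.ne']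
  simp only [scaledCutoff]
  refine ⟨?_, ?_, ?_⟩
  · have : t - δ * cutoff (δ⁻¹ * t) = δ * (δ⁻¹ * t - cutoff (δ⁻¹ * t)) := by
      rw [mul_sub, mul_inv_cancel_left₀ hδ.ne']
    rw [this, abs_mul, abs_of_pos hδ, le_div_iff₀ hδ]
    have h3 := abs_nonneg (δ⁻¹ * t - cutoff (δ⁻¹ * t))
    have h4 := mul_le_of_le_one_left h3 hδ1
    have h5 := mul_le_of_le_one_right (mul_nonneg hδ.le h3) hδ1
    linarith
  · rw [le_div_iff₀ hδ]
    have h3 := mul_le_of_le_one_right (abs_nonneg (1 - deriv cutoff (δ⁻¹ * t))) hδ1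
    linarith
  · rw [abs_mul, abs_of_pos (inv_pos.2 hδ), le_div_iff₀ hδ, mul_comm, mul_inv_cancel_left₀ hδ.ne']
    linarith

end Cutoff

section Shell

variable {d : ℕ}

lemma volume_real_ball_sdiff_le (hd : 1 ≤ d) {r t : ℝ} (hr : 0 < r) (ht : 0 ≤ t) (ht1 : t ≤ 1) :
    volume.real (Metric.ball (0 : E d) r \ Metric.ball (0 : E d) (r * (1 - t))) ≤
      r ^ d * (d * t) * volume.real (Metric.ball (0 : E d) 1) := by
  have hs : ∀ s : ℝ, 0 ≤ s → volume.real (Metric.ball (0 : E d) s) =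
      s ^ d * volume.real (Metric.ball (0 : E d) 1) := by
    intro s hs
    have : Nonempty (Fin d) := ⟨⟨0, hd⟩⟩
    rw [Measure.real, Measure.addHaar_ball _ _ hs, ENNReal.toReal_mul, ENNReal.toReal_ofReal
      (by positivity), finrank_euclideanSpace_fin, Measure.real]
  have hb : 1 + (d : ℝ) * (-t) ≤ (1 + -t) ^ d := one_add_mul_le_pow (by linarith) d
  rw [measureReal_sdiff (Metric.ball_subset_ball (by nlinarith)) measurableSet_ball
    measure_ball_lt_top.ne, hs (r * (1 - t)) (by nlinarith),
    hs r hr.le, mul_pow]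
  have h1 : 0 ≤ volume.real (Metric.ball (0 : E d) 1) := measureReal_nonneg
  have h2 : 0 < r ^ d := by positivity
  rw [← sub_mul]
  refine mul_le_mul_of_nonneg_right ?_ h1
  rw [← sub_eq_add_neg] at hb
  nlinarith

end Shell

/-- The test functions `θ(r² - |x|²) p(x)` with `p` a polynomial and `θ` a smooth function
vanishing near `(-∞, 0]`. -/
def IsTest {d : ℕ} (r : ℝ) (ψ : E d → ℝ) : Prop :=
  ∃ (θ : ℝ → ℝ) (δ : ℝ) (n : ℕ) (p : E d → ℝ), ContDiff ℝ (⊤ : ℕ∞) θ ∧ 0 < δ ∧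
    (∀ t ≤ δ, θ t = 0) ∧ IsPol n p ∧ ψ = fun x => θ (r ^ 2 - ‖x‖ ^ 2) * p x

section Uniqueness

variable {d : ℕ} {R : Finset (E d)} {k : E d → ℝ} {r : ℝ}

lemma continuous_wk (hkpos : ∀ α ∈ R, 0 < k α) : Continuous (wk R k) :=
  continuous_finsetProd _ fun α hα =>
    (continuous_id.inner continuous_const).abs.rpow_const fun _ => Or.inr (hkpos α hα).le

lemma wk_nonneg (x : E d) : 0 ≤ wk R k x :=
  Finset.prod_nonneg fun _ _ => Real.rpow_nonneg (abs_nonneg _) _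

lemma wk_ne_zero {x : E d} (hx : ∀ α ∈ R, ⟪α, x⟫ ≠ 0) : wk R k x ≠ 0 := by
  refine Finset.prod_ne_zero_iff.2 fun α hα => (Real.rpow_pos_of_pos (abs_pos.2 ?_) _).ne'
  rw [real_inner_comm]
  exact hx α hα

lemma continuous_extLap_of_isPol {n : ℕ} {p : E d → ℝ} (hp : IsPol n p) (hR0 : ∀ α ∈ R, α ≠ 0)
    (k : E d → ℝ) : Continuous (extLap R k p) :=
  (hp.extLap hR0 k).smooth.continuous

lemma exists_extLap_sub_bound (hR0 : ∀ α ∈ R, α ≠ 0) (k : E d → ℝ) {n : ℕ} {p : E d → ℝ}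
    (hp : IsPol n p) :
    ∃ M, 0 ≤ M ∧ ∀ δ : ℝ, 0 < δ → δ ≤ 1 → ∀ x ∈ Metric.closedBall (0 : E d) r,
      |extLap R k (fun x => (r ^ 2 - ‖x‖ ^ 2) * p x) x -
        extLap R k (fun x => scaledCutoff δ (r ^ 2 - ‖x‖ ^ 2) * p x) x| ≤ M / δ ∧
      (2 * δ < r ^ 2 - ‖x‖ ^ 2 → extLap R k (fun x => (r ^ 2 - ‖x‖ ^ 2) * p x) x -
        extLap R k (fun x => scaledCutoff δ (r ^ 2 - ‖x‖ ^ 2) * p x) x = 0) := by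
  set A : E d → ℝ := fun x => -2 * (d + ∑ α ∈ R, k α) * p x
    - 4 * ∑ i, x i * dd (EuclideanSpace.single i 1) p x with hA
  set C : E d → ℝ := fun x => 4 * ‖x‖ ^ 2 * p x with hC
  have hpc : Continuous p := hp.smooth.continuous
  have hddc : ∀ a, Continuous (dd a p) := fun a => (hp.smooth.dd a).continuous
  have hAc : Continuous A := by fun_prop
  have hCc : Continuous C := by fun_prop
  obtain ⟨M0, h0⟩ := (isCompact_closedBall (0 : E d) r).exists_bound_of_continuousOn
    (continuous_extLap_of_isPol hp hR0 k).continuousOn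
  obtain ⟨M1, h1⟩ := (isCompact_closedBall (0 : E d) r).exists_bound_of_continuousOn
    hAc.continuousOn
  obtain ⟨M2, h2⟩ := (isCompact_closedBall (0 : E d) r).exists_bound_of_continuousOn
    hCc.continuousOn
  obtain ⟨M, hM, hcut⟩ := exists_scaledCutoff_bound
  have hid : ∀ x, extLap R k (fun x => (r ^ 2 - ‖x‖ ^ 2) * p x) x =
      (r ^ 2 - ‖x‖ ^ 2) * extLap R k p x + A x := fun x => by
    have h := extLap_radial_mul hR0 k (θ := fun t => t) contDiff_id (r ^ 2) hp.smooth x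
    have hd : deriv (fun t : ℝ => t) = fun _ => 1 := by
      funext t; exact deriv_id t
    simp only [hd, deriv_const, zero_mul, add_zero, one_mul] at h
    exact h
  have hdiff : ∀ (δ : ℝ) x, extLap R k (fun x => (r ^ 2 - ‖x‖ ^ 2) * p x) x -
      extLap R k (fun x => scaledCutoff δ (r ^ 2 - ‖x‖ ^ 2) * p x) x =
      (r ^ 2 - ‖x‖ ^ 2 - scaledCutoff δ (r ^ 2 - ‖x‖ ^ 2)) * extLap R k p x +
      (1 - deriv (scaledCutoff δ) (r ^ 2 - ‖x‖ ^ 2)) * A x -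
      deriv (deriv (scaledCutoff δ)) (r ^ 2 - ‖x‖ ^ 2) * C x := fun δ x => by
    rw [hid, extLap_radial_mul hR0 k (contDiff_scaledCutoff δ) (r ^ 2) hp.smooth x]
    ring
  refine ⟨M * (|M0| + |M1| + |M2|), by positivity, fun δ hδ hδ1 x hx => ?_⟩
  have hz : 2 * δ < r ^ 2 - ‖x‖ ^ 2 → extLap R k (fun x => (r ^ 2 - ‖x‖ ^ 2) * p x) x -
      extLap R k (fun x => scaledCutoff δ (r ^ 2 - ‖x‖ ^ 2) * p x) x = 0 := fun h => by
    obtain ⟨e0, e1, e2⟩ := scaledCutoff_of_gt hδ h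
    rw [hdiff, e0, e1, e2]
    ring
  refine ⟨?_, hz⟩
  rcases lt_or_ge (2 * δ) (r ^ 2 - ‖x‖ ^ 2) with h | h
  · rw [hz h, abs_zero]
    positivity
  · have hxr : ‖x‖ ≤ r := mem_closedBall_zero_iff.1 hx
    obtain ⟨c0, c1, c2⟩ := hcut δ _ hδ hδ1 (by nlinarith [norm_nonneg x]) h
    have b0 : |extLap R k p x| ≤ |M0| := (h0 x hx).trans (le_abs_self _)
    have b1 : |A x| ≤ |M1| := (h1 x hx).trans (le_abs_self _)
    have b2 : |C x| ≤ |M2| := (h2 x hx).trans (le_abs_self _)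
    have hMδ : 0 ≤ M / δ := by positivity
    rw [hdiff]
    refine (abs_sub _ _).trans ((add_le_add (abs_add_le _ _) le_rfl).trans ?_)
    rw [abs_mul, abs_mul, abs_mul]
    have m0 := mul_le_mul c0 b0 (abs_nonneg _) hMδ
    have m1 := mul_le_mul c1 b1 (abs_nonneg _) hMδ
    have m2 := mul_le_mul c2 b2 (abs_nonneg _) hMδ
    calc _ ≤ M / δ * |M0| + M / δ * |M1| + M / δ * |M2| := add_le_add (add_le_add m0 m1) m2
      _ = _ := by ring

lemma exists_abs_le_of_shell {h : E d → ℝ} (hh : ContinuousOn h (Metric.closedBall (0 : E d) r))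
    (h0 : ∀ x ∈ Metric.sphere (0 : E d) r, h x = 0) {ε : ℝ} (hε : 0 < ε) :
    ∃ δ₀, 0 < δ₀ ∧ ∀ x ∈ Metric.closedBall (0 : E d) r, r ^ 2 - ‖x‖ ^ 2 ≤ δ₀ → |h x| ≤ ε := by
  have hcl : IsClosed (Metric.closedBall (0 : E d) r ∩ (fun x => |h x|) ⁻¹' Set.Ici ε) :=
    hh.abs.preimage_isClosed_of_isClosed Metric.isClosed_closedBall isClosed_Ici
  have hcp : IsCompact (Metric.closedBall (0 : E d) r ∩ (fun x => |h x|) ⁻¹' Set.Ici ε) :=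
    (isCompact_closedBall (0 : E d) r).of_isClosed_subset hcl Set.inter_subset_left
  rcases (Metric.closedBall (0 : E d) r ∩ (fun x => |h x|) ⁻¹' Set.Ici ε).eq_empty_or_nonempty
    with he | hne
  · refine ⟨1, one_pos, fun x hx _ => ?_⟩
    by_contra! hc
    exact Set.notMem_empty x (he ▸ ⟨hx, hc.le⟩)
  · obtain ⟨y, hy, hmin⟩ := hcp.exists_isMinOn hne
      (f := fun x : E d => r ^ 2 - ‖x‖ ^ 2) (by fun_prop)
    have hyr : ‖y‖ ≤ r := mem_closedBall_zero_iff.1 hy.1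
    have hyr' : ‖y‖ < r := hyr.lt_of_ne fun he => by
      have h1 : ε ≤ |h y| := hy.2
      rw [h0 y (mem_sphere_zero_iff_norm.2 he), abs_zero] at h1
      linarith
    have hpos : 0 < r ^ 2 - ‖y‖ ^ 2 := by nlinarith [norm_nonneg y]
    refine ⟨(r ^ 2 - ‖y‖ ^ 2) / 2, by positivity, fun x hx hxs => ?_⟩
    by_contra! hc
    have h1 : r ^ 2 - ‖y‖ ^ 2 ≤ r ^ 2 - ‖x‖ ^ 2 := hmin ⟨hx, hc.le⟩
    linarith

lemma integrableOn_ball_of_continuousOn {f : E d → ℝ}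
    (hf : ContinuousOn f (Metric.closedBall (0 : E d) r)) :
    IntegrableOn f (Metric.ball (0 : E d) r) :=
  (hf.integrableOn_compact (isCompact_closedBall _ _)).mono_set Metric.ball_subset_closedBall

end Uniqueness

section Uniqueness

variable {d : ℕ} {R : Finset (E d)} {k : E d → ℝ} {r : ℝ} {ψ : E d → ℝ}

lemma eq_zero_of_forall_abs_le_mul {a C : ℝ} (h : ∀ ε : ℝ, 0 < ε → |a| ≤ ε * C) : a = 0 := by
  by_contra ha
  have h1 : 0 < |a| := abs_pos.2 ha
  have h2 : 0 < |C| + 1 := by positivity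
  have h3 := h (|a| / (|C| + 1)) (by positivity)
  rw [div_mul_eq_mul_div, le_div_iff₀ h2] at h3
  nlinarith [le_abs_self C]

lemma isTest_scaledCutoff {δ : ℝ} (hδ : 0 < δ) {n : ℕ} {p : E d → ℝ} (hp : IsPol n p) :
    IsTest r (fun x => scaledCutoff δ (r ^ 2 - ‖x‖ ^ 2) * p x) :=
  ⟨_, δ, n, p, contDiff_scaledCutoff δ, hδ, fun _ => scaledCutoff_of_le hδ, hp, rfl⟩

lemma IsTest.smooth (hψ : IsTest r ψ) : Smooth ψ := by
  obtain ⟨θ, δ, n, p, hθ, hδ, hz, hp, rfl⟩ := hψ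
  exact (smooth_radial hθ _).mul hp.smooth

lemma IsTest.continuous_rootTerm (hψ : IsTest r ψ) {α : E d} (hα : α ≠ 0) :
    Continuous (rootTerm α ψ) := by
  obtain ⟨θ, δ, n, p, hθ, hδ, hz, hp, rfl⟩ := hψ
  have h1 := (hp.rootTerm hα).smooth.continuous
  have h2 := hp.smooth.continuous
  have h3 := hθ.continuous
  have h4 := (contDiff_deriv hθ).continuous
  rw [funext (rootTerm_radial_mul hθ (r ^ 2) hp.smooth hα)]
  fun_prop

lemma IsTest.continuous_extLap (hψ : IsTest r ψ) (hR0 : ∀ α ∈ R, α ≠ 0) (k : E d → ℝ) :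
    Continuous (extLap R k ψ) :=
  (Smooth.sumLap_continuous hψ.smooth).add (continuous_finsetSum _ fun α hα =>
    continuous_const.mul (hψ.continuous_rootTerm (hR0 α hα)))

lemma setIntegral_extLap_radius_mul_eq_zero (hd : 1 ≤ d) (hR0 : ∀ α ∈ R, α ≠ 0)
    (hkpos : ∀ α ∈ R, 0 < k α) (hr : 0 < r) {h : E d → ℝ}
    (hh : ContinuousOn h (Metric.closedBall (0 : E d) r))
    (h0 : ∀ x ∈ Metric.sphere (0 : E d) r, h x = 0)
    (hint : ∀ ψ, IsTest r ψ →
      ∫ x in Metric.ball (0 : E d) r, h x * (extLap R k ψ x * wk R k x) = 0)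
    {n : ℕ} {p : E d → ℝ} (hp : IsPol n p) :
    ∫ x in Metric.ball (0 : E d) r,
      h x * (extLap R k (fun x => (r ^ 2 - ‖x‖ ^ 2) * p x) x * wk R k x) = 0 := by
  obtain ⟨M, hM, hbound⟩ := exists_extLap_sub_bound (r := r) hR0 k hp
  have hwc : Continuous (wk R k) := continuous_wk hkpos
  obtain ⟨W, hW⟩ := (isCompact_closedBall (0 : E d) r).exists_bound_of_continuousOn
    hwc.continuousOn
  have hW0 : 0 ≤ W := (norm_nonneg _).trans (hW 0 (Metric.mem_closedBall_self hr.le))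
  set V := volume.real (Metric.ball (0 : E d) 1)
  refine eq_zero_of_forall_abs_le_mul (C := M * W * (r ^ d * (d * (2 / r ^ 2)) * V))
    fun ε hε => ?_
  obtain ⟨δ₀, hδ₀, hsm⟩ := exists_abs_le_of_shell hh h0 hε
  have hr2 : 0 < r ^ 2 := by positivity
  obtain ⟨δ, hδ, hδ1, hδ2, hδ3⟩ : ∃ δ : ℝ, 0 < δ ∧ δ ≤ 1 ∧ δ ≤ δ₀ / 4 ∧ δ ≤ r ^ 2 / 2 :=
    ⟨min 1 (min (δ₀ / 4) (r ^ 2 / 2)), by positivity, min_le_left _ _,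
      (min_le_right _ _).trans (min_le_left _ _), (min_le_right _ _).trans (min_le_right _ _)⟩
  obtain ⟨t, ht⟩ : ∃ t : ℝ, t = 2 * δ / r ^ 2 := ⟨_, rfl⟩
  have htr : r ^ 2 * t = 2 * δ := by rw [ht]; field_simp
  have ht0 : 0 ≤ t := by rw [ht]; positivity
  have ht1 : t ≤ 1 := by rw [ht, div_le_one hr2]; linarith
  have hψ := isTest_scaledCutoff (r := r) hδ hp
  have hec : Continuous (extLap R k (fun x => (r ^ 2 - ‖x‖ ^ 2) * p x)) :=
    continuous_extLap_of_isPol (hp.radius_mul r) hR0 k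
  have hψc := hψ.continuous_extLap hR0 k
  have hi1 := integrableOn_ball_of_continuousOn (hh.mul (hec.mul hwc).continuousOn)
  have hi2 := integrableOn_ball_of_continuousOn (hh.mul (hψc.mul hwc).continuousOn)
  have hI : ∫ x in Metric.ball (0 : E d) r,
      h x * (extLap R k (fun x => (r ^ 2 - ‖x‖ ^ 2) * p x) x * wk R k x) =
      ∫ x in Metric.ball (0 : E d) r \ Metric.ball (0 : E d) (r * (1 - t)),
        h x * ((extLap R k (fun x => (r ^ 2 - ‖x‖ ^ 2) * p x) x -
          extLap R k (fun x => scaledCutoff δ (r ^ 2 - ‖x‖ ^ 2) * p x) x) * wk R k x) := by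
    rw [← sub_zero (∫ x in Metric.ball (0 : E d) r, _), ← hint _ hψ]
    refine (integral_sub hi1 hi2).symm.trans ?_
    rw [← setIntegral_eq_of_subset_of_forall_sdiff_eq_zero measurableSet_ball
      Set.sdiff_subset]
    · congr 1
      funext x
      simp only [Pi.mul_apply]
      ring
    · rintro x ⟨hx, hxs⟩
      have hxt : ‖x‖ < r * (1 - t) := by
        by_contra hc
        exact hxs ⟨hx, fun hb => hc (mem_ball_zero_iff.1 hb)⟩
      have h1 : 2 * δ < r ^ 2 - ‖x‖ ^ 2 := by
        have h2 : ‖x‖ ^ 2 < (r * (1 - t)) ^ 2 := by gcongr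
        have h3 : (1 - t) ^ 2 ≤ 1 - t := by nlinarith
        nlinarith
      rw [(hbound δ hδ hδ1 x (Metric.ball_subset_closedBall hx)).2 h1]
      ring
  rw [hI]
  have hle := norm_setIntegral_le_of_norm_le_const (μ := volume)
    (s := Metric.ball (0 : E d) r \ Metric.ball (0 : E d) (r * (1 - t)))
    (f := fun x => h x * ((extLap R k (fun x => (r ^ 2 - ‖x‖ ^ 2) * p x) x -
      extLap R k (fun x => scaledCutoff δ (r ^ 2 - ‖x‖ ^ 2) * p x) x) * wk R k x))
    (C := ε * (M / δ * W)) ((measure_mono Set.sdiff_subset).trans_lt measure_ball_lt_top) (by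
      rintro x ⟨hx, hxs⟩
      have hxc := Metric.ball_subset_closedBall hx
      have hxt : r * (1 - t) ≤ ‖x‖ := by
        by_contra hc
        exact hxs (mem_ball_zero_iff.2 (not_le.1 hc))
      have h1 : |h x| ≤ ε := hsm x hxc (by
        have h2 : (r * (1 - t)) ^ 2 ≤ ‖x‖ ^ 2 := by
          have : 0 ≤ r * (1 - t) := mul_nonneg hr.le (by linarith)
          gcongr
        nlinarith)
      rw [norm_mul, norm_mul]
      exact mul_le_mul h1 (mul_le_mul (hbound δ hδ hδ1 x hxc).1 (hW x hxc) (norm_nonneg _)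
        (by positivity)) (by positivity) hε.le)
  refine hle.trans ((mul_le_mul_of_nonneg_left (volume_real_ball_sdiff_le hd hr ht0 ht1)
    (by positivity)).trans (le_of_eq ?_))
  rw [ht]
  field_simp
  rfl

/-- A continuous function vanishing on the sphere which is Dunkl-harmonic in the sense of
distributions vanishes. -/
lemma eq_zero_of_setIntegral_extLap_eq_zero (hd : 1 ≤ d) (hR0 : ∀ α ∈ R, α ≠ 0)
    (hkpos : ∀ α ∈ R, 0 < k α) (hm : 2 < (d : ℝ) + ∑ α ∈ R, k α) (hr : 0 < r) {h : E d → ℝ}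
    (hh : ContinuousOn h (Metric.closedBall (0 : E d) r))
    (h0 : ∀ x ∈ Metric.sphere (0 : E d) r, h x = 0)
    (hint : ∀ ψ, IsTest r ψ →
      ∫ x in Metric.ball (0 : E d) r, h x * (extLap R k ψ x * wk R k x) = 0) :
    ∀ x ∈ Metric.ball (0 : E d) r, h x = 0 := by
  have hpol : ∀ {n : ℕ} {g : E d → ℝ}, IsPol n g →
      ∫ x in Metric.ball (0 : E d) r, h x * (g x * wk R k x) = 0 := by
    intro n g hg
    obtain ⟨p, hp, hpg⟩ := exists_isPol_extLap_radius_mul_eq hR0 hkpos hm hr hg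
    simpa only [hpg] using setIntegral_extLap_radius_mul_eq_zero hd hR0 hkpos hr hh h0 hint hp
  have hwc : Continuous (wk R k) := continuous_wk hkpos
  have hhw : ContinuousOn (fun x => h x * wk R k x) (Metric.closedBall (0 : E d) r) :=
    hh.mul hwc.continuousOn
  have hi := integrableOn_ball_of_continuousOn (hh.mul (hh.mul hwc.continuousOn))
  obtain ⟨W, hW⟩ := (isCompact_closedBall (0 : E d) r).exists_bound_of_continuousOn hhw
  have hzero : ∫ x in Metric.ball (0 : E d) r, h x * (h x * wk R k x) = 0 := by
    refine eq_zero_of_forall_abs_le_mul (C := W * volume.real (Metric.ball (0 : E d) r))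
      fun ε hε => ?_
    obtain ⟨n, g, hg, hgh⟩ := exists_isPol_near hh hε
    have hig := integrableOn_ball_of_continuousOn
      (hh.mul (hg.smooth.continuous.mul hwc).continuousOn)
    have hI : ∫ x in Metric.ball (0 : E d) r, h x * (h x * wk R k x) =
        ∫ x in Metric.ball (0 : E d) r, (h x - g x) * (h x * wk R k x) := by
      rw [← sub_zero (∫ x in Metric.ball (0 : E d) r, _), ← hpol hg]
      refine (integral_sub hi hig).symm.trans ?_
      congr 1
      funext x
      simp only [Pi.mul_apply]
      ring
    rw [hI, ← mul_assoc, ← Real.norm_eq_abs]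
    refine norm_setIntegral_le_of_norm_le_const measure_ball_lt_top fun x hx => ?_
    have hxc := Metric.ball_subset_closedBall hx
    rw [norm_mul]
    refine mul_le_mul ?_ (hW x hxc) (norm_nonneg _) hε.le
    rw [Real.norm_eq_abs, abs_sub_comm]
    exact (hgh x hxc).le
  have hnn : ∀ x, 0 ≤ h x * (h x * wk R k x) := fun x => by
    rw [← mul_assoc]
    exact mul_nonneg (mul_self_nonneg _) (wk_nonneg x)
  have hae := (setIntegral_eq_zero_iff_of_nonneg_ae (Eventually.of_forall hnn) hi).1 hzero
  have hae' : h =ᵐ[volume.restrict (Metric.ball (0 : E d) r)] fun _ => 0 := by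
    filter_upwards [hae, ae_restrict_of_ae (ae_inner_ne_zero hR0)] with x hx hne
    have h1 : h x * (h x * wk R k x) = 0 := hx
    rw [← mul_assoc, mul_eq_zero, mul_self_eq_zero] at h1
    exact h1.resolve_right (wk_ne_zero hne)
  exact Measure.eqOn_open_of_ae_eq hae' Metric.isOpen_ball
    (hh.mono Metric.ball_subset_closedBall) continuousOn_const

end Uniqueness

section Approximation

variable {d : ℕ} {R : Finset (E d)} {k : E d → ℝ} {r : ℝ} {ψ : E d → ℝ}

lemma IsTest.eq_zero (hψ : IsTest r ψ) {x : E d} (hr : 0 ≤ r) (hx : r ≤ ‖x‖) : ψ x = 0 := by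
  obtain ⟨θ, δ, n, p, hθ, hδ, hz, hp, rfl⟩ := hψ
  have h : r ^ 2 ≤ ‖x‖ ^ 2 := by gcongr
  simp only [hz (r ^ 2 - ‖x‖ ^ 2) (by linarith), zero_mul]

lemma IsTest.extLap_eq_zero (hψ : IsTest r ψ) (hR0 : ∀ α ∈ R, α ≠ 0) (k : E d → ℝ) {x : E d}
    (hr : 0 ≤ r) (hx : r ≤ ‖x‖) : extLap R k ψ x = 0 := by
  obtain ⟨θ, δ, n, p, hθ, hδ, hz, hp, rfl⟩ := hψ
  have h : r ^ 2 ≤ ‖x‖ ^ 2 := by gcongr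
  have h0 : r ^ 2 - ‖x‖ ^ 2 < δ := by linarith
  have h1 : ∀ t < δ, deriv θ t = 0 := fun t ht => by
    have : θ =ᶠ[𝓝 t] fun _ => 0 := by
      filter_upwards [Iio_mem_nhds ht] with s hs using hz s (le_of_lt hs)
    rw [this.deriv_eq, deriv_const]
  have h2 : deriv (deriv θ) (r ^ 2 - ‖x‖ ^ 2) = 0 := by
    have : deriv θ =ᶠ[𝓝 (r ^ 2 - ‖x‖ ^ 2)] fun _ => 0 := by
      filter_upwards [Iio_mem_nhds h0] with s hs using h1 s hs
    rw [this.deriv_eq, deriv_const]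
  rw [extLap_radial_mul hR0 k hθ (r ^ 2) hp.smooth, h2, h1 _ h0, hz _ h0.le]
  ring

lemma setIntegral_extLap_comm (hRrefl : ∀ α ∈ R, ∀ β ∈ R, dunklReflect α β ∈ R)
    (hkinv : ∀ α ∈ R, ∀ β ∈ R, k (dunklReflect α β) = k β) (hR0 : ∀ α ∈ R, α ≠ 0)
    (hkpos : ∀ α ∈ R, 0 < k α) (hr : 0 ≤ r) {n : ℕ} {p : E d → ℝ} (hp : IsPol n p)
    (hψ : IsTest r ψ) :
    ∫ x in Metric.ball (0 : E d) r, p x * (extLap R k ψ x * wk R k x) =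
      ∫ x in Metric.ball (0 : E d) r, ψ x * (extLap R k p x * wk R k x) := by
  have hout : ∀ x ∉ Metric.ball (0 : E d) r, r ≤ ‖x‖ := fun x hx =>
    not_lt.1 fun h => hx (mem_ball_zero_iff.2 h)
  rw [setIntegral_eq_integral_of_forall_compl_eq_zero fun x hx => by
      rw [hψ.extLap_eq_zero hR0 k hr (hout x hx)]; ring,
    setIntegral_eq_integral_of_forall_compl_eq_zero fun x hx => by
      rw [hψ.eq_zero hr (hout x hx)]; ring]
  exact integral_extLap_comm hRrefl hkinv hR0 hkpos hp.smooth hψ.smooth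
    (fun α hα => (hp.rootTerm (hR0 α hα)).smooth.continuous)
    (fun α hα => hψ.continuous_rootTerm (hR0 α hα)) (ρ := r) fun x hx => hψ.eq_zero hr hx.le

lemma abs_sub_le_of_abs_extLap_sub_le (hR0 : ∀ α ∈ R, α ≠ 0) (hkpos : ∀ α ∈ R, 0 < k α)
    (hm : 2 < (d : ℝ) + ∑ α ∈ R, k α) {f g : E d → ℝ} (hf : Smooth f) (hg : Smooth g)
    {A C : ℝ} (hC : 0 < C)
    (hL : ∀ x ∈ Metric.closedBall (0 : E d) r, |extLap R k f x - extLap R k g x| ≤ C)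
    (hA : ∀ x ∈ Metric.sphere (0 : E d) r, |f x - g x| ≤ A) :
    ∀ x ∈ Metric.closedBall (0 : E d) r, |f x - g x| ≤ A + C * r ^ 2 := by
  have key : ∀ {f g : E d → ℝ}, Smooth f → Smooth g →
      (∀ x ∈ Metric.closedBall (0 : E d) r, |extLap R k f x - extLap R k g x| ≤ C) →
      (∀ x ∈ Metric.sphere (0 : E d) r, |f x - g x| ≤ A) →
      ∀ x ∈ Metric.closedBall (0 : E d) r, f x - g x ≤ A + C * r ^ 2 := by
    intro f g hf hg hL hA x hx
    have hg' : Smooth (fun x => (-1) * g x) := contDiff_const.mul hg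
    have h := le_of_neg_le_extLap hR0 hkpos hm (hf.add hg') hC (A := A) (r := r) (fun y hy => by
      have h1 := neg_le_of_abs_le (hL y (Metric.ball_subset_closedBall hy))
      rw [extLap_add R k hf hg', extLap_const_mul R k hg]
      linarith) (fun y hy => by
      have h1 := le_of_abs_le (hA y hy)
      linarith) hx
    linarith
  intro x hx
  refine abs_sub_le_iff.2 ⟨key hf hg hL hA x hx, key hg hf ?_ ?_ x hx⟩
  · exact fun y hy => by rw [abs_sub_comm]; exact hL y hy
  · exact fun y hy => by rw [abs_sub_comm]; exact hA y hy

lemma tendsto_setIntegral_mul {F : ℕ → E d → ℝ} {f G : E d → ℝ}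
    (hF : TendstoUniformlyOn F f atTop (Metric.closedBall (0 : E d) r))
    (hFc : ∀ n, ContinuousOn (F n) (Metric.closedBall (0 : E d) r))
    (hG : ContinuousOn G (Metric.closedBall (0 : E d) r)) :
    Tendsto (fun n => ∫ x in Metric.ball (0 : E d) r, F n x * G x) atTop
      (𝓝 (∫ x in Metric.ball (0 : E d) r, f x * G x)) := by
  have hfc := hF.continuousOn (Frequently.of_forall hFc)
  obtain ⟨M, hM⟩ := (isCompact_closedBall (0 : E d) r).exists_bound_of_continuousOn hG
  set V := volume.real (Metric.ball (0 : E d) r)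
  have hV : 0 ≤ V := measureReal_nonneg
  refine Metric.tendsto_atTop.2 fun ε hε => ?_
  obtain ⟨N, hN⟩ := eventually_atTop.1
    (Metric.tendstoUniformlyOn_iff.1 hF (ε / (|M| * V + 1)) (by positivity))
  refine ⟨N, fun n hn => ?_⟩
  have h1 : IntegrableOn (fun x => F n x * G x) (Metric.ball (0 : E d) r) :=
    integrableOn_ball_of_continuousOn ((hFc n).mul hG)
  have h2 : IntegrableOn (fun x => f x * G x) (Metric.ball (0 : E d) r) :=
    integrableOn_ball_of_continuousOn (hfc.mul hG)
  rw [Real.dist_eq, ← integral_sub h1 h2, ← Real.norm_eq_abs]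
  have hle := norm_setIntegral_le_of_norm_le_const (μ := volume) (s := Metric.ball (0 : E d) r)
    (f := fun x => F n x * G x - f x * G x) (C := ε / (|M| * V + 1) * |M|)
    measure_ball_lt_top fun x hx => by
      have hxc := Metric.ball_subset_closedBall hx
      have h1 := hN n hn x hxc
      rw [dist_comm, Real.dist_eq] at h1
      rw [← sub_mul, norm_mul]
      exact mul_le_mul h1.le ((hM x hxc).trans (le_abs_self _)) (norm_nonneg _) (by positivity)
  refine hle.trans_lt ?_
  have h2 : 0 < |M| * V + 1 := by positivity
  rw [div_mul_eq_mul_div, div_mul_eq_mul_div, div_lt_iff₀ h2]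
  nlinarith

/-- A distributional solution of `Δ_k w = g` can be approximated uniformly by polynomials `P` such
that `Δ_k P` approximates `g` uniformly. -/
lemma exists_isPol_near_of_setIntegral_eq (hd : 1 ≤ d)
    (hRrefl : ∀ α ∈ R, ∀ β ∈ R, dunklReflect α β ∈ R)
    (hkinv : ∀ α ∈ R, ∀ β ∈ R, k (dunklReflect α β) = k β) (hR0 : ∀ α ∈ R, α ≠ 0)
    (hkpos : ∀ α ∈ R, 0 < k α) (hm : 2 < (d : ℝ) + ∑ α ∈ R, k α) (hr : 0 < r) {w g : E d → ℝ}
    (hw : ContinuousOn w (Metric.closedBall (0 : E d) r))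
    (hg : ContinuousOn g (Metric.closedBall (0 : E d) r))
    (hsol : ∀ ψ, IsTest r ψ →
      ∫ x in Metric.ball (0 : E d) r, w x * (extLap R k ψ x * wk R k x) =
        ∫ x in Metric.ball (0 : E d) r, g x * (ψ x * wk R k x)) {η : ℝ} (hη : 0 < η) :
    ∃ n P, IsPol n P ∧ ∀ x ∈ Metric.closedBall (0 : E d) r,
      |extLap R k P x - g x| ≤ η ∧ |P x - w x| ≤ η := by
  have hsub : Metric.sphere (0 : E d) r ⊆ Metric.closedBall 0 r := Metric.sphere_subset_closedBall
  have hstep : ∀ j : ℕ, ∃ P : E d → ℝ, (∃ n, IsPol n P) ∧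
      (∀ x ∈ Metric.closedBall (0 : E d) r, |extLap R k P x - g x| ≤ 1 / ((j : ℝ) + 1)) ∧
      ∀ x ∈ Metric.sphere (0 : E d) r, |P x - w x| ≤ 1 / ((j : ℝ) + 1) := by
    intro j
    obtain ⟨n, q, hq, hqw⟩ := exists_isPol_near hw (Nat.one_div_pos_of_nat (α := ℝ) (n := j))
    obtain ⟨m, f, hf, hfg⟩ := exists_isPol_near hg (Nat.one_div_pos_of_nat (α := ℝ) (n := j))
    obtain ⟨N, P, hP, hPf, hPq⟩ := exists_isPol_extLap_eq hR0 hkpos hm hr hq hf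
    refine ⟨P, ⟨N, hP⟩, fun x hx => ?_, fun x hx => ?_⟩
    · rw [hPf]
      exact (hfg x hx).le
    · rw [hPq x hx]
      exact (hqw x (hsub hx)).le
  choose P hPpol hPg hPw using hstep
  have hPs : ∀ j, Smooth (P j) := fun j => (hPpol j).elim fun _ h => h.smooth
  set b : ℕ → ℝ := fun j => 2 * (1 / ((j : ℝ) + 1)) + 2 * (1 / ((j : ℝ) + 1)) * r ^ 2 with hb
  have hlim1 : Tendsto (fun j : ℕ => 1 / ((j : ℝ) + 1)) atTop (𝓝 0) :=
    tendsto_one_div_add_atTop_nhds_zero_nat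
  have hblim : Tendsto b atTop (𝓝 0) := by
    have h := (hlim1.const_mul 2).add ((hlim1.const_mul 2).mul_const (r ^ 2))
    rwa [mul_zero, zero_mul, add_zero] at h
  have hcomp : ∀ i j, i ≤ j → ∀ x ∈ Metric.closedBall (0 : E d) r, |P i x - P j x| ≤ b i := by
    intro i j hij
    have h1 : 1 / ((j : ℝ) + 1) ≤ 1 / ((i : ℝ) + 1) := Nat.one_div_le_one_div hij
    refine abs_sub_le_of_abs_extLap_sub_le hR0 hkpos hm (hPs i) (hPs j) (by positivity)
      (fun x hx => ?_) fun x hx => ?_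
    · have h2 := abs_sub_le (extLap R k (P i) x) (g x) (extLap R k (P j) x)
      have h3 := hPg i x hx
      have h4 := hPg j x hx
      rw [abs_sub_comm] at h4
      linarith
    · have h2 := abs_sub_le (P i x) (w x) (P j x)
      have h3 := hPw i x hx
      have h4 := hPw j x hx
      rw [abs_sub_comm] at h4
      linarith
  have hex : ∀ x ∈ Metric.closedBall (0 : E d) r, ∃ y, Tendsto (fun j => P j x) atTop (𝓝 y) := by
    intro x hx
    refine cauchySeq_tendsto_of_complete (cauchySeq_of_le_tendsto_0' b (fun i j hij => ?_) hblim)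
    rw [Real.dist_eq]
    exact hcomp i j hij x hx
  choose! W hW using hex
  have hPW : ∀ i, ∀ x ∈ Metric.closedBall (0 : E d) r, |P i x - W x| ≤ b i := fun i x hx =>
    le_of_tendsto (tendsto_const_nhds.sub (hW x hx)).abs
      (eventually_atTop.2 ⟨i, fun j hij => hcomp i j hij x hx⟩)
  have hunif : TendstoUniformlyOn P W atTop (Metric.closedBall (0 : E d) r) := by
    refine Metric.tendstoUniformlyOn_iff.2 fun ε hε => ?_
    filter_upwards [hblim.eventually_lt_const hε] with i hi x hx
    rw [dist_comm, Real.dist_eq]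
    exact (hPW i x hx).trans_lt hi
  have hunifg : TendstoUniformlyOn (fun j => extLap R k (P j)) g atTop
      (Metric.closedBall (0 : E d) r) := by
    refine Metric.tendstoUniformlyOn_iff.2 fun ε hε => ?_
    filter_upwards [hlim1.eventually_lt_const hε] with i hi x hx
    rw [dist_comm, Real.dist_eq]
    exact (hPg i x hx).trans_lt hi
  have hPc : ∀ j, ContinuousOn (P j) (Metric.closedBall (0 : E d) r) := fun j =>
    (hPs j).continuous.continuousOn
  have hWc : ContinuousOn W (Metric.closedBall (0 : E d) r) :=
    hunif.continuousOn (Frequently.of_forall hPc)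
  have hWs : ∀ x ∈ Metric.sphere (0 : E d) r, w x = W x := by
    intro x hx
    refine tendsto_nhds_unique ?_ (hW x (hsub hx))
    refine tendsto_iff_dist_tendsto_zero.2 (squeeze_zero (fun _ => dist_nonneg) (fun j => ?_) hlim1)
    rw [Real.dist_eq]
    exact hPw j x hx
  have hwc : Continuous (wk R k) := continuous_wk hkpos
  have hWsol : ∀ ψ, IsTest r ψ →
      ∫ x in Metric.ball (0 : E d) r, W x * (extLap R k ψ x * wk R k x) =
        ∫ x in Metric.ball (0 : E d) r, g x * (ψ x * wk R k x) := by
    intro ψ hψ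
    refine tendsto_nhds_unique
      (tendsto_setIntegral_mul hunif hPc ((hψ.continuous_extLap hR0 k).mul hwc).continuousOn) ?_
    have h := tendsto_setIntegral_mul hunifg (fun j => (hPpol j).elim fun _ h =>
      (continuous_extLap_of_isPol h hR0 k).continuousOn)
      (hψ.smooth.continuous.mul hwc).continuousOn
    refine h.congr fun j => ?_
    obtain ⟨n, hn⟩ := hPpol j
    refine Eq.trans ?_ (setIntegral_extLap_comm hRrefl hkinv hR0 hkpos hr.le hn hψ).symm
    congr 1
    funext x
    simp only [Pi.mul_apply]
    ring
  have heq : ∀ x ∈ Metric.ball (0 : E d) r, w x - W x = 0 := by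
    refine eq_zero_of_setIntegral_extLap_eq_zero hd hR0 hkpos hm hr (hw.sub hWc)
      (fun x hx => sub_eq_zero.2 (hWs x hx)) fun ψ hψ => ?_
    have hec := ((hψ.continuous_extLap hR0 k).mul hwc).continuousOn
      (s := Metric.closedBall (0 : E d) r)
    have h := integral_sub (integrableOn_ball_of_continuousOn (hw.mul hec))
      (integrableOn_ball_of_continuousOn (hWc.mul hec))
    simp only [Pi.mul_apply] at h
    rw [hsol ψ hψ, hWsol ψ hψ, sub_self] at h
    simpa only [sub_mul] using h
  obtain ⟨j, hj1, hj2⟩ := ((hlim1.eventually_lt_const hη).and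
    (hblim.eventually_lt_const hη)).exists
  obtain ⟨n, hn⟩ := hPpol j
  refine ⟨n, P j, hn, fun x hx => ⟨(hPg j x hx).trans hj1.le, ?_⟩⟩
  have hwW : w x = W x := by
    rcases (mem_closedBall_zero_iff.1 hx).lt_or_eq with h | h
    · exact sub_eq_zero.1 (heq x (mem_ball_zero_iff.2 h))
    · exact hWs x (mem_sphere_zero_iff_norm.2 h)
  rw [hwW]
  exact (hPW j x hx).trans hj2.le

end Approximation

section Comparison

variable {d : ℕ} {R : Finset (E d)} {k : E d → ℝ} {r : ℝ} {ψ : E d → ℝ}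

lemma IsTest.tsupport_subset (hψ : IsTest r ψ) (hr : 0 ≤ r) :
    tsupport ψ ⊆ Metric.ball (0 : E d) r := by
  obtain ⟨θ, δ, n, p, hθ, hδ, hz, hp, rfl⟩ := hψ
  have hcl : IsClosed {x : E d | δ ≤ r ^ 2 - ‖x‖ ^ 2} :=
    isClosed_le continuous_const (by fun_prop)
  refine (closure_minimal (fun x hx => ?_) hcl).trans fun x hx => ?_
  · by_contra hc
    refine hx ?_
    simp only [hz _ (not_le.1 hc).le, zero_mul]
  · have h1 : δ ≤ r ^ 2 - ‖x‖ ^ 2 := hx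
    exact mem_ball_zero_iff.2 (lt_of_pow_lt_pow_left₀ 2 hr (by linarith))

lemma IsTest.hasCompactSupport (hψ : IsTest r ψ) (hr : 0 ≤ r) : HasCompactSupport ψ :=
  HasCompactSupport.intro (isCompact_closedBall (0 : E d) r) fun x hx =>
    hψ.eq_zero hr (by
      rw [mem_closedBall_zero_iff, not_le] at hx
      exact hx.le)

lemma IsDunklSol.setIntegral_eq {φ : ℝ → ℝ} {u : E d → ℝ}
    (hu : IsDunklSol R k φ (Metric.ball 0 r) u) (hR0 : ∀ α ∈ R, α ≠ 0) (hr : 0 ≤ r)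
    (hψ : IsTest r ψ) :
    ∫ x in Metric.ball (0 : E d) r, u x * (extLap R k ψ x * wk R k x) =
      ∫ x in Metric.ball (0 : E d) r, φ (u x) * (ψ x * wk R k x) := by
  have h := hu ψ hψ.smooth (hψ.hasCompactSupport hr) (hψ.tsupport_subset hr)
  simp only [mul_assoc] at h
  rw [← h]
  refine integral_congr_ae ?_
  filter_upwards [ae_restrict_of_ae (ae_inner_ne_zero hR0)] with x hx
  rw [dunklLap_eq_extLap R k hψ.smooth hx]

lemma continuousOn_of_locally_lipschitz {φ : ℝ → ℝ}
    (hφ : ∀ x ∈ Set.Ici (0 : ℝ), ∃ K : NNReal, ∃ s ∈ nhdsWithin x (Set.Ici 0),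
      LipschitzOnWith K φ s) : ContinuousOn φ (Set.Ici 0) := by
  intro x hx
  obtain ⟨K, s, hs, hK⟩ := hφ x hx
  exact (hK.continuousOn x (mem_of_mem_nhdsWithin hx hs)).mono_of_mem_nhdsWithin hs

end Comparison

/-- comparison principle for distributional solutions of Δ_k w = φ(w) on a ball. -/
theorem dunkl_comparison
    (d : ℕ) (hd : 1 ≤ d)
    (R : Finset (E d)) (hR0 : ∀ α ∈ R, α ≠ 0)
    (hRline : ∀ α ∈ R, (R : Set (E d)) ∩ {x | ∃ c : ℝ, x = c • α} = {α, -α})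
    (hRrefl : ∀ α ∈ R, ∀ β ∈ R, dunklReflect α β ∈ R)
    (k : E d → ℝ) (hkpos : ∀ α ∈ R, 0 < k α)
    (hkinv : ∀ α ∈ R, ∀ β ∈ R, k (dunklReflect α β) = k β)
    (hm : 2 < (d : ℝ) + ∑ α ∈ R, k α)
    (φ : ℝ → ℝ) (hφ0 : φ 0 = 0)
    (hφmono : MonotoneOn φ (Set.Ici 0))
    (hφnonneg : ∀ t : ℝ, 0 ≤ t → 0 ≤ φ t)
    (hφlip : ∀ x ∈ Set.Ici (0 : ℝ), ∃ K : NNReal, ∃ s ∈ nhdsWithin x (Set.Ici 0),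
      LipschitzOnWith K φ s)
    (r : ℝ) (hr : 0 < r)
    (u v : E d → ℝ)
    (hu : ContinuousOn u (closure (Metric.ball (0 : E d) r)))
    (hv : ContinuousOn v (closure (Metric.ball (0 : E d) r)))
    (hu0 : ∀ x ∈ closure (Metric.ball (0 : E d) r), 0 ≤ u x)
    (hv0 : ∀ x ∈ closure (Metric.ball (0 : E d) r), 0 ≤ v x)
    (husol : IsDunklSol R k φ (Metric.ball 0 r) u)
    (hvsol : IsDunklSol R k φ (Metric.ball 0 r) v)
    (hbd : ∀ x ∈ frontier (Metric.ball (0 : E d) r), v x ≤ u x) :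
    ∀ x ∈ Metric.ball (0 : E d) r, v x ≤ u x := by
  rw [closure_ball _ hr.ne'] at hu hv hu0 hv0
  rw [frontier_ball _ hr.ne'] at hbd
  have hφc := continuousOn_of_locally_lipschitz hφlip
  have hφu : ContinuousOn (fun x => φ (u x)) (Metric.closedBall (0 : E d) r) := hφc.comp hu hu0
  have hφv : ContinuousOn (fun x => φ (v x)) (Metric.closedBall (0 : E d) r) := hφc.comp hv hv0
  have hwc : Continuous (wk R k) := continuous_wk hkpos
  have hsol : ∀ ψ, IsTest r ψ →
      ∫ x in Metric.ball (0 : E d) r, (v x - u x) * (extLap R k ψ x * wk R k x) =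
        ∫ x in Metric.ball (0 : E d) r, (φ (v x) - φ (u x)) * (ψ x * wk R k x) := by
    intro ψ hψ
    have hec := ((hψ.continuous_extLap hR0 k).mul hwc).continuousOn
      (s := Metric.closedBall (0 : E d) r)
    have hpc := (hψ.smooth.continuous.mul hwc).continuousOn (s := Metric.closedBall (0 : E d) r)
    have h1 := integral_sub (integrableOn_ball_of_continuousOn (hv.mul hec))
      (integrableOn_ball_of_continuousOn (hu.mul hec))
    have h2 := integral_sub (integrableOn_ball_of_continuousOn (hφv.mul hpc))
      (integrableOn_ball_of_continuousOn (hφu.mul hpc))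
    simp only [Pi.mul_apply] at h1 h2
    rw [hvsol.setIntegral_eq hR0 hr.le hψ, husol.setIntegral_eq hR0 hr.le hψ, ← h2] at h1
    simpa only [sub_mul] using h1
  intro x₁ hx₁
  by_contra! hlt
  set c := (v x₁ - u x₁) / (4 * r ^ 2) with hc
  have hcr : c * r ^ 2 = (v x₁ - u x₁) / 4 := by
    rw [hc]
    field_simp
  have hvu : 0 < v x₁ - u x₁ := sub_pos.2 hlt
  have hc0 : 0 < c := by positivity
  obtain ⟨η, hη, hη1, hη2⟩ : ∃ η : ℝ, 0 < η ∧ η ≤ c ∧ η ≤ (v x₁ - u x₁) / 8 :=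
    ⟨min c ((v x₁ - u x₁) / 8), by positivity, min_le_left _ _, min_le_right _ _⟩
  obtain ⟨n, P, hP, hPn⟩ := exists_isPol_near_of_setIntegral_eq hd hRrefl hkinv hR0 hkpos hm hr
    (hv.sub hu) (hφv.sub hφu) hsol hη
  have hsq : Smooth (fun x : E d => c * ‖x‖ ^ 2) := contDiff_const.mul (contDiff_norm_sq ℝ)
  have hF : Smooth (fun x => P x + c * ‖x‖ ^ 2) := hP.smooth.add hsq
  have hx₁c := Metric.ball_subset_closedBall hx₁
  obtain ⟨x₀, hx₀, hmax⟩ := (isCompact_closedBall (0 : E d) r).exists_isMaxOn ⟨x₁, hx₁c⟩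
    hF.continuous.continuousOn
  have hle : P x₁ + c * ‖x₁‖ ^ 2 ≤ P x₀ + c * ‖x₀‖ ^ 2 := hmax hx₁c
  have ha := abs_sub_le_iff.1 (hPn x₀ hx₀).2
  have hb := abs_sub_le_iff.1 (hPn x₁ hx₁c).2
  have hl := abs_sub_le_iff.1 (hPn x₀ hx₀).1
  simp only [Pi.sub_apply] at ha hb hl
  have hx₀r : ‖x₀‖ ≤ r := mem_closedBall_zero_iff.1 hx₀
  have hn0 : c * ‖x₀‖ ^ 2 ≤ c * r ^ 2 := by gcongr
  have hn1 : 0 ≤ c * ‖x₁‖ ^ 2 := by positivity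
  have hpos : 0 < v x₀ - u x₀ := by linarith [ha.1, hb.2]
  have hx₀b : x₀ ∈ Metric.ball (0 : E d) r := by
    refine mem_ball_zero_iff.2 (hx₀r.lt_of_ne fun he => ?_)
    have := hbd x₀ (mem_sphere_zero_iff_norm.2 he)
    linarith
  have hmono : φ (u x₀) ≤ φ (v x₀) := hφmono (hu0 x₀ hx₀) (hv0 x₀ hx₀) (by linarith)
  have hext := extLap_nonpos_of_isMax hkpos hF hx₀b hmax
  rw [extLap_add R k hP.smooth hsq, extLap_const_mul R k (contDiff_norm_sq ℝ),
    extLap_norm_sq hR0] at hext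
  nlinarith [hl.2]
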